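/- Let V be a separable real Hilbert space with orthonormal basis e = (e_k)_{k ∈ ℕ}, and let X and X_n, n ∈ ℕ, be V-valued stochastically continuous stochastic processes on [0,T] with càdlàg trajectories. Then the following are equivalent: (a) X_n → X in probability in the product M₁ metric, i.e. P(d_M^e(X_n, X) ≥ ε) → 0 for every ε > 0, where d_M^e(f,g) := Σ_{k=1}^∞ 2^{−k} d_M(⟨f, e_k⟩, ⟨g, e_k⟩) / (1 + d_M(⟨f, e_k⟩, ⟨g, e_k⟩)); (b) for every k ∈ ℕ both of the following hold: (i) for every t ∈ [0,T], ⟨X_n(t), e_k⟩ → ⟨X(t), e_k⟩ in probability, and (ii) for every ε > 0, lim_{δ ↘ 0} limsup_{n → ∞} P( M(⟨X_n, e_k⟩; δ) ≥ ε ) = 0. -/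

import Mathlib

noncomputable section

open Filter Set Topology

/-- Distance from `v` to the segment joining `v₁` and `v₂`:
`M(v₁, v, v₂) = inf_{α ∈ [0,1]} ‖v − (α v₁ + (1 − α) v₂)‖`. -/
def segDist {V : Type*} [NormedAddCommGroup V] [NormedSpace ℝ V]
    (v₁ v v₂ : V) : ℝ :=
  sInf {d : ℝ | ∃ α ∈ Set.Icc (0:ℝ) 1, d = ‖v - (α • v₁ + (1 - α) • v₂)‖}

/-- Left limit `f(t−)` of `f` at `t` for the interval starting at `a`, with `f(a−) := f(a)`. -/
def leftLimIn {V : Type*} [NormedAddCommGroup V] (f : ℝ → V) (a t : ℝ) : V :=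
  if a < t then Function.leftLim f t else f a

/-- `f` is càdlàg on `[a,b]`: right-continuous at every `t ∈ [a,b)` and
having a left limit at every `t ∈ (a,b]`. -/
def IsCadlagOn {V : Type*} [NormedAddCommGroup V] (f : ℝ → V) (a b : ℝ) : Prop :=
  (∀ t ∈ Set.Ico a b, Filter.Tendsto f (nhdsWithin t (Set.Ioc t b)) (nhds (f t))) ∧
  (∀ t ∈ Set.Ioc a b, ∃ l, Filter.Tendsto f (nhdsWithin t (Set.Ico a t)) (nhds l))

/-- The extended graph `Γ(f)` of `f` on `[a,b]`. -/
def extGraph {V : Type*} [NormedAddCommGroup V] [NormedSpace ℝ V]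
    (f : ℝ → V) (a b : ℝ) : Set (ℝ × V) :=
  {p | p.1 ∈ Set.Icc a b ∧ ∃ α ∈ Set.Icc (0:ℝ) 1,
      p.2 = α • leftLimIn f a p.1 + (1 - α) • f p.1}

/-- The total order on the extended graph of `f`. -/
def graphLE {V : Type*} [NormedAddCommGroup V] (f : ℝ → V) (a : ℝ) (p q : ℝ × V) : Prop :=
  p.1 < q.1 ∨ (p.1 = q.1 ∧ ‖leftLimIn f a p.1 - p.2‖ ≤ ‖leftLimIn f a p.1 - q.2‖)

/-- `(r, u)` is a parametric representation of the extended graph of `f` on `[a,b]`: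
a continuous nondecreasing surjection of `[0,1]` onto `Γ(f)` with the correct endpoints. -/
structure IsParamRep {V : Type*} [NormedAddCommGroup V] [NormedSpace ℝ V]
    (f : ℝ → V) (a b : ℝ) (r : ℝ → ℝ) (u : ℝ → V) : Prop where
  contOn : ContinuousOn (fun s => (r s, u s)) (Set.Icc 0 1)
  mem : ∀ s ∈ Set.Icc (0:ℝ) 1, (r s, u s) ∈ extGraph f a b
  surj : ∀ p ∈ extGraph f a b, ∃ s ∈ Set.Icc (0:ℝ) 1, (r s, u s) = p
  mono : ∀ s₁ ∈ Set.Icc (0:ℝ) 1, ∀ s₂ ∈ Set.Icc (0:ℝ) 1,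
      s₁ ≤ s₂ → graphLE f a (r s₁, u s₁) (r s₂, u s₂)
  init : r 0 = a ∧ u 0 = f a
  last : r 1 = b ∧ u 1 = f b

/-- The strong `M₁` Skorokhod metric on `D([a,b];V)`. -/
def dM {V : Type*} [NormedAddCommGroup V] [NormedSpace ℝ V]
    (a b : ℝ) (f₁ f₂ : ℝ → V) : ℝ :=
  sInf {d : ℝ | ∃ r₁ u₁ r₂ u₂, IsParamRep f₁ a b r₁ u₁ ∧ IsParamRep f₂ a b r₂ u₂ ∧
    d = max (⨆ s : Set.Icc (0:ℝ) 1, |r₁ s.1 - r₂ s.1|)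
            (⨆ s : Set.Icc (0:ℝ) 1, ‖u₁ s.1 - u₂ s.1‖)}

/-- The oscillation function `M(f; δ)` on `[a,b]`. -/
def oscM {V : Type*} [NormedAddCommGroup V] [NormedSpace ℝ V]
    (f : ℝ → V) (a b δ : ℝ) : ℝ :=
  sSup {d : ℝ | ∃ t₁ t t₂ : ℝ, a ≤ t₁ ∧ t₁ < t ∧ t < t₂ ∧ t₂ ≤ b ∧ t₂ - t₁ ≤ δ ∧
    d = segDist (f t₁) (f t) (f t₂)}

end

/-- The product `M₁` metric `d_M^e` associated with the orthonormal basis `e`: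
`d_M^e(f,g) = Σ_k 2^{−(k+1)} d_M(⟨f,e_k⟩, ⟨g,e_k⟩)/(1 + d_M(⟨f,e_k⟩, ⟨g,e_k⟩))`
(indices shifted since `k` runs over `ℕ` starting at `0`). -/
noncomputable def dMe {V : Type*} [NormedAddCommGroup V] [InnerProductSpace ℝ V]
    (T : ℝ) (e : ℕ → V) (f g : ℝ → V) : ℝ :=
  ∑' k : ℕ, (1/2 : ℝ) ^ (k + 1) *
    (dM 0 T (fun t => (@inner ℝ V _ (f t) (e k))) (fun t => (@inner ℝ V _ (g t) (e k))) /
      (1 + dM 0 T (fun t => (@inner ℝ V _ (f t) (e k))) (fun t => (@inner ℝ V _ (g t) (e k)))))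

section Auxiliary

open Filter Set Topology

/-- The signed amount by which `v` leaves the interval spanned by `v₁` and `v₂`. -/
def exceed (v₁ v v₂ : ℝ) : ℝ := max (v - max v₁ v₂) (min v₁ v₂ - v)

lemma exceed_neg (v₁ v v₂ : ℝ) : exceed (-v₁) (-v) (-v₂) = exceed v₁ v v₂ := by
  unfold exceed
  rw [max_neg_neg, min_neg_neg, max_comm]
  congr 1 <;> ring

lemma continuous_exceed : Continuous fun p : ℝ × ℝ × ℝ => exceed p.1 p.2.1 p.2.2 := by
  unfold exceed; fun_prop

lemma exceed_le_iff {v₁ v v₂ c : ℝ} :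
    exceed v₁ v v₂ ≤ c ↔ v ≤ max v₁ v₂ + c ∧ min v₁ v₂ - c ≤ v := by
  unfold exceed
  rw [max_le_iff]
  constructor <;> rintro ⟨h, h'⟩ <;> constructor <;> linarith

lemma exceed_le_add {v₁ v v₂ w₁ w w₂ η : ℝ} (h₁ : |v₁ - w₁| ≤ η) (h : |v - w| ≤ η)
    (h₂ : |v₂ - w₂| ≤ η) : exceed v₁ v v₂ ≤ exceed w₁ w w₂ + 2 * η := by
  obtain ⟨ha, hb⟩ := exceed_le_iff.1 (le_refl (exceed w₁ w w₂))
  rw [abs_le] at h₁ h h₂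
  have h3 : max w₁ w₂ ≤ max v₁ v₂ + η := by
    rw [← max_add_add_right]; apply max_le_max <;> linarith
  have h4 : min v₁ v₂ - η ≤ min w₁ w₂ := by
    rw [← min_sub_sub_right]; apply min_le_min <;> linarith
  rw [exceed_le_iff]
  constructor <;> linarith

lemma segDist_eq (v₁ v v₂ : ℝ) : segDist v₁ v v₂ = max 0 (exceed v₁ v v₂) := by
  have hbd : BddBelow {d : ℝ | ∃ α ∈ Set.Icc (0:ℝ) 1, d = ‖v - (α • v₁ + (1 - α) • v₂)‖} :=
    ⟨0, by rintro _ ⟨α, -, rfl⟩; exact norm_nonneg _⟩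
  have key : ∀ w ∈ segment ℝ v₂ v₁, segDist v₁ v v₂ ≤ |v - w| := by
    rw [segment_eq_image]
    rintro _ ⟨α, hα, rfl⟩
    refine csInf_le hbd ⟨α, hα, ?_⟩
    simp only [Real.norm_eq_abs]
    congr 2; ring
  apply le_antisymm
  · have hw := key (max (min v₁ v₂) (min v (max v₁ v₂))) (by
      rw [segment_eq_uIcc, uIcc_comm, uIcc]
      exact ⟨le_max_left _ _, max_le (min_le_max) (min_le_right _ _)⟩)
    refine hw.trans ?_
    have hm : min v₁ v₂ ≤ max v₁ v₂ := min_le_max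
    rw [abs_le]
    unfold exceed
    generalize min v₁ v₂ = a at *
    generalize max v₁ v₂ = b at *
    rcases le_total v b with h | h <;> rcases le_total v a with h' | h' <;>
      simp only [min_eq_left, min_eq_right, max_eq_left, max_eq_right, h, h', hm] <;>
      constructor <;>
      linarith [le_max_left 0 (max (v - b) (a - v)), le_max_right 0 (max (v - b) (a - v)),
        le_max_left (v - b) (a - v), le_max_right (v - b) (a - v)]
  · refine le_csInf ⟨_, 0, by simp, rfl⟩ ?_
    rintro _ ⟨α, hα, rfl⟩
    refine max_le (norm_nonneg _) ?_
    have h : α • v₁ + (1 - α) • v₂ ∈ segment ℝ v₁ v₂ :=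
      ⟨α, 1 - α, hα.1, by linarith [hα.2], by ring, rfl⟩
    rw [segment_eq_uIcc] at h
    obtain ⟨h1, h2⟩ := h
    rw [Real.norm_eq_abs]
    refine max_le ?_ ?_
    · refine le_trans ?_ (le_abs_self _)
      exact sub_le_sub_left h2 _
    · refine le_trans ?_ (neg_le_abs _)
      rw [neg_sub]
      exact sub_le_sub_right h1 _

lemma oscM_nonneg (f : ℝ → ℝ) (a b δ : ℝ) : 0 ≤ oscM f a b δ := by
  refine Real.sSup_nonneg ?_
  rintro _ ⟨t₁, t, t₂, -, -, -, -, -, rfl⟩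
  rw [segDist_eq]
  exact le_max_left _ _

lemma oscM_le {f : ℝ → ℝ} {a b δ c : ℝ} (hc : 0 ≤ c)
    (h : ∀ t₁ t t₂, a ≤ t₁ → t₁ < t → t < t₂ → t₂ ≤ b → t₂ - t₁ ≤ δ →
      exceed (f t₁) (f t) (f t₂) ≤ c) : oscM f a b δ ≤ c := by
  refine Real.sSup_le ?_ hc
  rintro _ ⟨t₁, t, t₂, h1, h2, h3, h4, h5, rfl⟩
  rw [segDist_eq]
  exact max_le hc (h _ _ _ h1 h2 h3 h4 h5)

lemma exceed_le_oscM {f : ℝ → ℝ} {a b δ B : ℝ} (hB : ∀ t ∈ Icc a b, |f t| ≤ B) {t₁ t t₂ : ℝ}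
    (h1 : a ≤ t₁) (h2 : t₁ < t) (h3 : t < t₂) (h4 : t₂ ≤ b) (h5 : t₂ - t₁ ≤ δ) :
    exceed (f t₁) (f t) (f t₂) ≤ oscM f a b δ := by
  refine le_trans (le_max_right 0 _) ?_
  rw [← segDist_eq]
  refine le_csSup ⟨2 * B, ?_⟩ ⟨t₁, t, t₂, h1, h2, h3, h4, h5, rfl⟩
  rintro _ ⟨t₁, t, t₂, h1, h2, h3, h4, h5, rfl⟩
  have e1 := abs_le.1 (hB t₁ ⟨by linarith, by linarith⟩)
  have e2 := abs_le.1 (hB t ⟨by linarith, by linarith⟩)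
  have e3 := abs_le.1 (hB t₂ ⟨by linarith, by linarith⟩)
  rw [segDist_eq]
  refine max_le (by linarith) (exceed_le_iff.2 ⟨?_, ?_⟩)
  · linarith [le_max_left (f t₁) (f t₂)]
  · linarith [min_le_left (f t₁) (f t₂)]

lemma oscM_neg (f : ℝ → ℝ) (a b δ : ℝ) : oscM (fun t => - f t) a b δ = oscM f a b δ := by
  simp only [oscM, segDist_eq, exceed_neg]

/-- Two pairs of points `(a, a')` and `(b, b')` are joined by a pair of continuous nondecreasing
time changes along which the relation `Q` holds. -/
def Align (Q : ℝ → ℝ → Prop) (a a' b b' : ℝ) : Prop :=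
  ∃ l m : ℝ → ℝ, Continuous l ∧ Continuous m ∧ Monotone l ∧ Monotone m ∧
    (∀ x ≤ 0, l x = a ∧ m x = a') ∧ (∀ x, 1 ≤ x → l x = b ∧ m x = b') ∧ ∀ x, Q (l x) (m x)

lemma Align.refl {Q : ℝ → ℝ → Prop} {a a' : ℝ} (h : Q a a') : Align Q a a' a a' :=
  ⟨fun _ => a, fun _ => a', continuous_const, continuous_const, monotone_const, monotone_const,
    fun _ _ => ⟨rfl, rfl⟩, fun _ _ => ⟨rfl, rfl⟩, fun _ => h⟩

lemma Align.trans {Q : ℝ → ℝ → Prop} {a a' b b' c c' : ℝ} (h : Align Q a a' b b')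
    (h' : Align Q b b' c c') : Align Q a a' c c' := by
  obtain ⟨l, m, hl, hm, hlm, hmm, h0, h1, hQ⟩ := h
  obtain ⟨l', m', hl', hm', hlm', hmm', h0', h1', hQ'⟩ := h'
  refine ⟨fun x => l (2 * x) + l' (2 * x - 1) - b, fun x => m (2 * x) + m' (2 * x - 1) - b',
    by fun_prop, by fun_prop, ?_, ?_, ?_, ?_, ?_⟩
  · intro x y hxy
    have := hlm (show 2 * x ≤ 2 * y by linarith)
    have := hlm' (show 2 * x - 1 ≤ 2 * y - 1 by linarith)
    dsimp only; linarith
  · intro x y hxy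
    have := hmm (show 2 * x ≤ 2 * y by linarith)
    have := hmm' (show 2 * x - 1 ≤ 2 * y - 1 by linarith)
    dsimp only; linarith
  · intro x hx
    have e1 := h0 (2 * x) (by linarith)
    have e2 := h0' (2 * x - 1) (by linarith)
    constructor <;> dsimp only <;> linarith [e1.1, e1.2, e2.1, e2.2]
  · intro x hx
    have e1 := h1 (2 * x) (by linarith)
    have e2 := h1' (2 * x - 1) (by linarith)
    constructor <;> dsimp only <;> linarith [e1.1, e1.2, e2.1, e2.2]
  · intro x
    rcases le_total (2 * x) 1 with hx | hx
    · have e2 := h0' (2 * x - 1) (by linarith)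
      simpa [e2.1, e2.2] using hQ (2 * x)
    · have e2 := h1 (2 * x) hx
      simpa [e2.1, e2.2] using hQ' (2 * x - 1)

/-- A continuous path which is monotone up to `ε` can be reparametrised so as to be close to
the affine path with the same endpoints. -/
lemma exists_reparam_affine {p : ℝ → ℝ} (hp : Continuous p) {a b ε η : ℝ} (hab : a < b)
    (hη : 0 < η) (hosc : ∀ x y z, a ≤ x → x ≤ y → y ≤ z → z ≤ b →
      exceed (p x) (p y) (p z) ≤ ε) :
    ∃ l : ℝ → ℝ, Continuous l ∧ Monotone l ∧ (∀ x ≤ 0, l x = a) ∧ (∀ x, 1 ≤ x → l x = b) ∧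
      (∀ x, l x ∈ Icc a b) ∧
      ∀ x ∈ Icc (0 : ℝ) 1, |p (l x) - ((1 - x) * p a + x * p b)| ≤ 3 * ε + η := by
  wlog hle : p a ≤ p b generalizing p
  · obtain ⟨l, h1, h2, h3, h4, h5, h6⟩ := this (p := fun x => - p x) hp.neg
      (fun x y z hx hxy hyz hz => by
        rw [exceed_neg]; exact hosc x y z hx hxy hyz hz) (by
        push Not at hle; linarith)
    refine ⟨l, h1, h2, h3, h4, h5, fun x hx => ?_⟩
    have := h6 x hx
    rw [← abs_neg]
    convert this using 2
    ring
  have hε : 0 ≤ ε := by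
    have := (exceed_le_iff.1 (hosc a a a le_rfl le_rfl le_rfl hab.le)).1
    simp only [max_self] at this; linarith
  set F : ℝ → ℝ → ℝ := fun y x => p (a + x * (max y a - a)) with hF
  have hFc : Continuous (Function.uncurry F) := by
    simp only [hF, Function.uncurry_def]; fun_prop
  set M : ℝ → ℝ := fun y => sSup (F y '' Icc 0 1) with hM
  have hMc : Continuous M := isCompact_Icc.continuous_sSup hFc
  have hbdd : ∀ y, BddAbove (F y '' Icc 0 1) := fun y =>
    (isCompact_Icc.image (by simp only [hF]; fun_prop)).bddAbove
  have hne : ∀ y, (F y '' Icc (0:ℝ) 1).Nonempty := fun y => ⟨_, 0, by simp, rfl⟩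
  have himg : ∀ y, ∀ z ∈ Icc a (max y a), p z ≤ M y := by
    intro y z hz
    rcases (le_max_right y a).eq_or_lt with h | h
    · refine le_csSup (hbdd y) ⟨0, by simp, ?_⟩
      simp only [hF]
      rw [← h] at hz ⊢
      rw [show z = a from le_antisymm hz.2 hz.1]; simp
    · refine le_csSup (hbdd y) ⟨(z - a) / (max y a - a), ⟨?_, ?_⟩, ?_⟩
      · exact div_nonneg (by linarith [hz.1]) (by linarith)
      · rw [div_le_one (by linarith)]; linarith [hz.2]
      · simp only [hF]
        rw [div_mul_cancel₀ _ (by linarith)]; congr 1; ring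
  have hMle : ∀ y c, (∀ z ∈ Icc a (max y a), p z ≤ c) → M y ≤ c := by
    intro y c hc
    refine csSup_le (hne y) ?_
    rintro _ ⟨x, hx, rfl⟩
    have h := le_max_right y a
    refine hc _ ⟨?_, ?_⟩ <;> nlinarith [hx.1, hx.2]
  have hMm : Monotone M := fun y y' hy => hMle y _ fun z hz =>
    himg y' z ⟨hz.1, hz.2.trans (max_le_max hy le_rfl)⟩
  have hMa : M a = p a := by
    apply le_antisymm
    · exact hMle a _ fun z hz => by
        rw [max_self] at hz; rw [le_antisymm hz.2 hz.1]
    · exact himg a a (by simp)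
  have hMbot : ∀ y ≤ a, M y = p a := fun y hy => by
    apply le_antisymm
    · exact hMa ▸ hMm hy
    · exact himg y a ⟨le_rfl, le_max_right _ _⟩
  have hMp : ∀ y ∈ Icc a b, p y ≤ M y ∧ M y ≤ p y + 2 * ε := by
    intro y hy
    refine ⟨himg y y ⟨hy.1, le_max_left _ _⟩, hMle y _ fun z hz => ?_⟩
    rw [max_eq_left hy.1] at hz
    have h1 := (exceed_le_iff.1 (hosc z y b hz.1 hz.2 hy.2 le_rfl)).2
    have h2 := (exceed_le_iff.1 (hosc a z b le_rfl hz.1 (hz.2.trans hy.2) le_rfl)).1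
    rw [max_eq_right hle] at h2
    rcases min_choice (p z) (p b) with h | h <;> rw [h] at h1 <;> linarith
  have hMb : M b ≤ p b + ε := hMle b _ fun z hz => by
    rw [max_eq_left hab.le] at hz
    have h2 := (exceed_le_iff.1 (hosc a z b le_rfl hz.1 hz.2 le_rfl)).1
    rwa [max_eq_right hle] at h2
  set c : ℝ := η / (b - a) with hc
  have hc0 : 0 < c := div_pos hη (by linarith)
  have hcb : c * (b - a) = η := div_mul_cancel₀ _ (by linarith)
  set Φ : ℝ → ℝ := fun y => M y + c * (y - a) with hΦ
  have hΦs : StrictMono Φ := fun y y' hy => by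
    have := hMm hy.le
    simp only [hΦ]
    nlinarith
  have hΦsurj : Function.Surjective Φ := by
    refine Continuous.surjective (by fun_prop) ?_ ?_
    · refine tendsto_atTop_mono' _ (f₁ := fun y => p a + c * (y - a)) ?_ ?_
      · filter_upwards [eventually_ge_atTop a] with y hy
        have := hMa ▸ hMm hy
        simp only [hΦ]; linarith
      · refine tendsto_atTop_add_const_left _ _ (Tendsto.const_mul_atTop hc0 ?_)
        exact tendsto_atTop_add_const_right _ _ tendsto_id
    · refine Tendsto.congr' (f₁ := fun y => p a + c * (y - a)) ?_ ?_
      · filter_upwards [eventually_le_atBot a] with y hy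
        simp only [hΦ, hMbot y hy]
      · refine tendsto_atBot_add_const_left _ _ (Tendsto.const_mul_atBot hc0 ?_)
        exact tendsto_atBot_add_const_right _ _ tendsto_id
  set e := StrictMono.orderIsoOfSurjective Φ hΦs hΦsurj with he
  have hΦe : ∀ y, Φ (e.symm y) = y := fun y => e.apply_symm_apply y
  have heΦ : ∀ y, e.symm (Φ y) = y := fun y => e.symm_apply_apply y
  set k : ℝ → ℝ := fun x => max 0 (min 1 x) with hk
  have hkc : Continuous k := by simp only [hk]; fun_prop
  have hkm : Monotone k := fun x y h => max_le_max le_rfl (min_le_min le_rfl h)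
  have hk0 : ∀ x, 0 ≤ k x := fun x => le_max_left _ _
  have hk1 : ∀ x, k x ≤ 1 := fun x => max_le zero_le_one (min_le_left _ _)
  have hΦab : Φ a < Φ b := hΦs hab
  refine ⟨fun x => e.symm (Φ a + k x * (Φ b - Φ a)), e.symm.continuous.comp (by fun_prop),
    fun x y h => e.symm.monotone (by nlinarith [hkm h]), ?_, ?_, ?_, ?_⟩
  · intro x hx
    have : k x = 0 := by simp only [hk]; rw [max_eq_left]; exact (min_le_right _ _).trans hx
    simp only [this, zero_mul, add_zero, heΦ]
  · intro x hx
    have : k x = 1 := by simp only [hk]; rw [min_eq_left hx]; simp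
    simp only [this, one_mul, add_sub_cancel, heΦ]
  · intro x
    constructor
    · conv_lhs => rw [← heΦ a]
      exact e.symm.monotone (by nlinarith [hk0 x])
    · conv_rhs => rw [← heΦ b]
      exact e.symm.monotone (by nlinarith [hk1 x])
  · intro x hx
    have hkx : k x = x := by simp only [hk]; rw [min_eq_right hx.2, max_eq_right hx.1]
    simp only [hkx]
    set y := e.symm (Φ a + x * (Φ b - Φ a)) with hy
    have hya : a ≤ y := by
      conv_lhs => rw [← heΦ a]
      exact e.symm.monotone (by nlinarith [hx.1])
    have hyb : y ≤ b := by
      conv_rhs => rw [← heΦ b]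
      exact e.symm.monotone (by nlinarith [hx.2])
    have h1 : M y + c * (y - a) = (1 - x) * p a + x * (M b + η) := by
      have := hΦe (Φ a + x * (Φ b - Φ a))
      rw [← hy] at this
      simp only [hΦ, hMa, hcb] at this
      rw [this]; ring
    have h2 := hMp y ⟨hya, hyb⟩
    have h3 := (hMp b ⟨hab.le, le_rfl⟩).1
    have h4 : 0 ≤ c * (y - a) := mul_nonneg hc0.le (by linarith)
    have h5 : c * (y - a) ≤ η := by rw [← hcb]; exact mul_le_mul_of_nonneg_left (by linarith) hc0.le
    obtain ⟨hx0, hx1⟩ := hx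
    have h6 : x * (M b + η) ≤ x * p b + (ε + η) := by nlinarith
    have h7 : x * p b ≤ x * (M b + η) := by nlinarith
    rw [abs_le]
    constructor <;> linarith

/-- Two continuous paths which are monotone up to `ε` and have `ε`-close endpoints can be
aligned by time changes. -/
lemma align_of_exceed_le {p q : ℝ → ℝ} (hp : Continuous p) (hq : Continuous q) {a b c d ε : ℝ}
    (hab : a < b) (hcd : c < d) (hε : 0 < ε)
    (hpo : ∀ x y z, a ≤ x → x ≤ y → y ≤ z → z ≤ b → exceed (p x) (p y) (p z) ≤ ε)
    (hqo : ∀ x y z, c ≤ x → x ≤ y → y ≤ z → z ≤ d → exceed (q x) (q y) (q z) ≤ ε)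
    (h1 : |p a - q c| ≤ ε) (h2 : |p b - q d| ≤ ε) :
    Align (fun x y => x ∈ Icc a b ∧ y ∈ Icc c d ∧ |p x - q y| ≤ 9 * ε) a c b d := by
  obtain ⟨l, l1, l2, l3, l4, l5, l6⟩ := exists_reparam_affine hp hab hε hpo
  obtain ⟨m, m1, m2, m3, m4, m5, m6⟩ := exists_reparam_affine hq hcd hε hqo
  refine ⟨l, m, l1, m1, l2, m2, fun x hx => ⟨l3 x hx, m3 x hx⟩, fun x hx => ⟨l4 x hx, m4 x hx⟩,
    fun x => ⟨l5 x, m5 x, ?_⟩⟩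
  rcases le_total x 0 with h | h
  · rw [l3 x h, m3 x h]; linarith
  rcases le_total 1 x with h' | h'
  · rw [l4 x h', m4 x h']; linarith
  have e1 := abs_le.1 (l6 x ⟨h, h'⟩)
  have e2 := abs_le.1 (m6 x ⟨h, h'⟩)
  rw [abs_le] at h1 h2 ⊢
  constructor <;> nlinarith

lemma IsCadlagOn.tendsto_leftLimIn {f : ℝ → ℝ} {a b : ℝ} (h : IsCadlagOn f a b) {t : ℝ}
    (ht : t ∈ Ioc a b) : Tendsto f (𝓝[<] t) (𝓝 (leftLimIn f a t)) := by
  obtain ⟨l, hl⟩ := h.2 t ht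
  rw [nhdsWithin_Ico_eq_nhdsLT ht.1] at hl
  rw [leftLimIn, if_pos ht.1]
  exact tendsto_leftLim_of_tendsto ⟨l, hl⟩

lemma leftLimIn_self (f : ℝ → ℝ) (a : ℝ) : leftLimIn f a a = f a := by simp [leftLimIn]

lemma mem_extGraph_iff {f : ℝ → ℝ} {a b t v : ℝ} :
    (t, v) ∈ extGraph f a b ↔ t ∈ Icc a b ∧ v ∈ uIcc (leftLimIn f a t) (f t) := by
  rw [← segment_eq_uIcc]
  refine and_congr_right fun _ => ?_
  constructor
  · rintro ⟨α, hα, h⟩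
    exact ⟨α, 1 - α, hα.1, by linarith [hα.2], by ring, h.symm⟩
  · rintro ⟨α, β, h1, h2, h3, h⟩
    refine ⟨α, ⟨h1, by linarith⟩, ?_⟩
    rw [← h, show 1 - α = β by linarith]

lemma mem_extGraph_self {f : ℝ → ℝ} {a b t : ℝ} (ht : t ∈ Icc a b) :
    (t, f t) ∈ extGraph f a b := mem_extGraph_iff.2 ⟨ht, right_mem_uIcc⟩

section LeftLimits

variable {f L : ℝ → ℝ} {a b : ℝ}

lemma exists_left_near (hL : ∀ t ∈ Ioc a b, Tendsto f (𝓝[<] t) (𝓝 (L t))) {t η : ℝ}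
    (ht : t ∈ Ioc a b) (hη : 0 < η) : ∃ t', a ≤ t' ∧ t' < t ∧ t - η < t' ∧ |f t' - L t| < η := by
  have h1 := (hL t ht).eventually (Metric.ball_mem_nhds (L t) hη)
  have h2 : ∀ᶠ s in 𝓝[<] t, s ∈ Ioo (max a (t - η)) t :=
    Ioo_mem_nhdsLT (max_lt ht.1 (by linarith))
  obtain ⟨s, hs, hs'⟩ := (h1.and h2).exists
  exact ⟨s, (le_max_left _ _).trans hs'.1.le, hs'.2, (le_max_right _ _).trans_lt hs'.1, hs⟩

lemma exists_near_le (hL : ∀ t ∈ Ioc a b, Tendsto f (𝓝[<] t) (𝓝 (L t))) (ha : L a = f a)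
    {t v η : ℝ} (ht : t ∈ Icc a b) (hv : v ∈ uIcc (L t) (f t)) (hη : 0 < η) :
    ∃ t', a ≤ t' ∧ t' ≤ t ∧ t - η < t' ∧ f t' ≤ v + η := by
  rcases le_total (f t) (L t) with h | h
  · rw [uIcc_of_ge h] at hv
    exact ⟨t, ht.1, le_rfl, by linarith, by linarith [hv.1]⟩
  rw [uIcc_of_le h] at hv
  rcases ht.1.eq_or_lt with rfl | h'
  · exact ⟨a, le_rfl, le_rfl, by linarith, by linarith [hv.1]⟩
  · obtain ⟨t', h1, h2, h3, h4⟩ := exists_left_near hL ⟨h', ht.2⟩ hη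
    exact ⟨t', h1, h2.le, h3, by linarith [(abs_lt.1 h4).2, hv.1]⟩

lemma exists_near_ge (hL : ∀ t ∈ Ioc a b, Tendsto f (𝓝[<] t) (𝓝 (L t))) (ha : L a = f a)
    {t v η : ℝ} (ht : t ∈ Icc a b) (hv : v ∈ uIcc (L t) (f t)) (hη : 0 < η) :
    ∃ t', a ≤ t' ∧ t' ≤ t ∧ t - η < t' ∧ v - η ≤ f t' := by
  obtain ⟨t', h1, h2, h3, h4⟩ := exists_near_le (f := fun t => - f t) (L := fun t => - L t)
    (v := -v) (fun t ht => (hL t ht).neg) (by simp [ha]) ht (by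
      rw [mem_uIcc] at hv ⊢; rcases hv with hv | hv
      · right; constructor <;> linarith [hv.1, hv.2]
      · left; constructor <;> linarith [hv.1, hv.2]) hη
  exact ⟨t', h1, h2, h3, by linarith⟩

/-- A point of the extended graph lying strictly above two points surrounding it can be
approximated by actual values of the function at strictly ordered times. -/
lemma exists_times_of_max_lt (hL : ∀ t ∈ Ioc a b, Tendsto f (𝓝[<] t) (𝓝 (L t))) (ha : L a = f a)
    {t₁ t t₂ v₁ v v₂ η : ℝ} (h1 : a ≤ t₁) (h12 : t₁ ≤ t) (h23 : t ≤ t₂) (h3 : t₂ ≤ b)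
    (hv₁ : v₁ ∈ uIcc (L t₁) (f t₁)) (hv : v ∈ uIcc (L t) (f t)) (hv₂ : v₂ ∈ uIcc (L t₂) (f t₂))
    (hord₁ : t₁ = t → |L t₁ - v₁| ≤ |L t₁ - v|) (hord₂ : t = t₂ → |L t - v| ≤ |L t - v₂|)
    (hlt : max v₁ v₂ < v) (hη : 0 < η) :
    ∃ s₁ s s₂, a ≤ s₁ ∧ s₁ < s ∧ s < s₂ ∧ s₂ ≤ b ∧ s₂ - s₁ ≤ t₂ - t₁ + η ∧
      f s₁ ≤ v₁ + η ∧ v - η ≤ f s ∧ f s₂ ≤ v₂ + η := by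
  obtain ⟨hlt₁, hlt₂⟩ := max_lt_iff.1 hlt
  have hup : t₁ = t → L t ≤ v₁ ∧ v ≤ f t := by
    rintro rfl
    have h := hord₁ rfl
    rcases le_total (L t₁) (f t₁) with h' | h'
    · rw [uIcc_of_le h'] at hv hv₁
      exact ⟨hv₁.1, hv.2⟩
    · rw [uIcc_of_ge h'] at hv hv₁
      rw [abs_of_nonneg (by linarith [hv₁.2]), abs_of_nonneg (by linarith [hv.2])] at h
      linarith
  have hdown : t = t₂ → f t ≤ v₂ ∧ v ≤ L t := by
    rintro rfl
    have h := hord₂ rfl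
    rcases le_total (L t) (f t) with h' | h'
    · rw [uIcc_of_le h'] at hv hv₂
      rw [abs_of_nonpos (by linarith [hv.1]), abs_of_nonpos (by linarith [hv₂.1])] at h
      linarith
    · rw [uIcc_of_ge h'] at hv hv₂
      exact ⟨hv₂.1, hv.2⟩
  have hta : a < t := by
    rcases (h1.trans h12).eq_or_lt with h | h
    · exfalso
      have : t₁ = t := by linarith
      subst this
      have := hup rfl
      rw [← h, ha, uIcc_self] at hv hv₁
      rw [hv, hv₁] at hlt₁
      exact lt_irrefl _ hlt₁
    · exact h
  rcases h12.eq_or_lt with e1 | e1 <;> rcases h23.eq_or_lt with e2 | e2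
  · exfalso
    linarith [hup e1, hdown e2]
  · obtain ⟨hu1, hu2⟩ := hup e1
    obtain ⟨s₁, p1, p2, p3, p4⟩ := exists_left_near hL (η := η / 2) ⟨hta, h23.trans h3⟩ (by linarith)
    obtain ⟨s₂, q1, q2, q3, q4⟩ := exists_near_le hL ha (η := min η (t₂ - t))
      ⟨h1.trans (h12.trans h23), h3⟩ hv₂ (lt_min hη (by linarith))
    have := min_le_left η (t₂ - t)
    have := min_le_right η (t₂ - t)
    exact ⟨s₁, t, s₂, p1, p2, by linarith, by linarith, by linarith,
      by linarith [(abs_lt.1 p4).2], by linarith, by linarith⟩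
  · obtain ⟨hd1, hd2⟩ := hdown e2
    obtain ⟨s₁, p1, p2, p3, p4⟩ := exists_near_le hL ha ⟨h1, h12.trans (h23.trans h3)⟩ hv₁ hη
    obtain ⟨s, q1, q2, q3, q4⟩ := exists_left_near hL (η := min η (t - t₁)) ⟨hta, h23.trans h3⟩
      (lt_min hη (by linarith))
    have := min_le_left η (t - t₁)
    have := min_le_right η (t - t₁)
    exact ⟨s₁, s, t, p1, by linarith, q2, by linarith, by linarith, p4,
      by linarith [(abs_lt.1 q4).1], by linarith⟩
  · obtain ⟨s₁, p1, p2, p3, p4⟩ := exists_near_le hL ha ⟨h1, h12.trans (h23.trans h3)⟩ hv₁ hη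
    obtain ⟨s, q1, q2, q3, q4⟩ := exists_near_ge hL ha (η := min η (t - t₁))
      ⟨hta.le, h23.trans h3⟩ hv (lt_min hη (by linarith))
    obtain ⟨s₂, r1, r2, r3, r4⟩ := exists_near_le hL ha (η := min η (t₂ - t))
      ⟨h1.trans (h12.trans h23), h3⟩ hv₂ (lt_min hη (by linarith))
    have := min_le_left η (t - t₁)
    have := min_le_right η (t - t₁)
    have := min_le_left η (t₂ - t)
    have := min_le_right η (t₂ - t)
    exact ⟨s₁, s, s₂, p1, by linarith, by linarith, by linarith, by linarith, p4,
      by linarith, by linarith⟩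

lemma sub_max_le_oscM (hL : ∀ t ∈ Ioc a b, Tendsto f (𝓝[<] t) (𝓝 (L t))) (ha : L a = f a)
    {B : ℝ} (hB : ∀ t ∈ Icc a b, |f t| ≤ B)
    {t₁ t t₂ v₁ v v₂ δ : ℝ} (h1 : a ≤ t₁) (h12 : t₁ ≤ t) (h23 : t ≤ t₂) (h3 : t₂ ≤ b)
    (hv₁ : v₁ ∈ uIcc (L t₁) (f t₁)) (hv : v ∈ uIcc (L t) (f t)) (hv₂ : v₂ ∈ uIcc (L t₂) (f t₂))
    (hord₁ : t₁ = t → |L t₁ - v₁| ≤ |L t₁ - v|) (hord₂ : t = t₂ → |L t - v| ≤ |L t - v₂|)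
    (hδ : t₂ - t₁ < δ) : v - max v₁ v₂ ≤ oscM f a b δ := by
  rcases le_or_gt v (max v₁ v₂) with hle | hlt
  · linarith [oscM_nonneg f a b δ]
  refine le_of_forall_pos_le_add fun ε hε => ?_
  have hη : 0 < min (ε / 2) (δ - (t₂ - t₁)) := lt_min (by linarith) (by linarith)
  obtain ⟨s₁, s, s₂, k1, k2, k3, k4, k5, k6, k7, k8⟩ :=
    exists_times_of_max_lt hL ha h1 h12 h23 h3 hv₁ hv hv₂ hord₁ hord₂ hlt hη
  have m1 := min_le_left (ε / 2) (δ - (t₂ - t₁))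
  have m2 := min_le_right (ε / 2) (δ - (t₂ - t₁))
  have h := (exceed_le_iff.1 (exceed_le_oscM (δ := δ) hB k1 k2 k3 k4 (by linarith))).1
  have h' : max (f s₁) (f s₂) ≤ max v₁ v₂ + ε / 2 := by
    rw [← max_add_add_right]; apply max_le_max <;> linarith
  linarith

end LeftLimits

namespace IsParamRep

variable {f : ℝ → ℝ} {a b : ℝ} {r u : ℝ → ℝ}

lemma continuousOn_fst (h : IsParamRep f a b r u) : ContinuousOn r (Icc 0 1) :=
  continuous_fst.comp_continuousOn h.contOn

lemma continuousOn_snd (h : IsParamRep f a b r u) : ContinuousOn u (Icc 0 1) :=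
  continuous_snd.comp_continuousOn h.contOn

lemma monotoneOn_fst (h : IsParamRep f a b r u) : MonotoneOn r (Icc 0 1) := by
  intro s hs s' hs' hss
  rcases h.mono s hs s' hs' hss with h' | h'
  · exact h'.le
  · exact h'.1.le

lemma exists_bound_snd (h : IsParamRep f a b r u) : ∃ B, ∀ s ∈ Icc (0 : ℝ) 1, |u s| ≤ B :=
  isCompact_Icc.exists_bound_of_continuousOn h.continuousOn_snd

lemma exists_bound (h : IsParamRep f a b r u) : ∃ B, ∀ t ∈ Icc a b, |f t| ≤ B := by
  obtain ⟨B, hB⟩ := h.exists_bound_snd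
  refine ⟨B, fun t ht => ?_⟩
  obtain ⟨s, hs, he⟩ := h.surj _ (mem_extGraph_self ht)
  rw [← (Prod.mk.inj he).2]
  exact hB s hs

/-- The excess of a parametric representation is controlled by the oscillation function. -/
lemma exceed_le_oscM (h : IsParamRep f a b r u) (hf : IsCadlagOn f a b) {s₁ s s₂ δ : ℝ}
    (h1 : 0 ≤ s₁) (h12 : s₁ ≤ s) (h23 : s ≤ s₂) (h3 : s₂ ≤ 1) (hδ : r s₂ - r s₁ < δ) :
    exceed (u s₁) (u s) (u s₂) ≤ oscM f a b δ := by
  obtain ⟨B, hB⟩ := h.exists_bound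
  have m₁ : s₁ ∈ Icc (0 : ℝ) 1 := ⟨h1, by linarith⟩
  have m : s ∈ Icc (0 : ℝ) 1 := ⟨by linarith, by linarith⟩
  have m₂ : s₂ ∈ Icc (0 : ℝ) 1 := ⟨by linarith, h3⟩
  have g₁ := mem_extGraph_iff.1 (h.mem s₁ m₁)
  have g := mem_extGraph_iff.1 (h.mem s m)
  have g₂ := mem_extGraph_iff.1 (h.mem s₂ m₂)
  have o₁ : r s₁ = r s →
      |leftLimIn f a (r s₁) - u s₁| ≤ |leftLimIn f a (r s₁) - u s| := fun e =>
    ((h.mono s₁ m₁ s m h12).resolve_left (not_lt.2 e.ge)).2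
  have o₂ : r s = r s₂ → |leftLimIn f a (r s) - u s| ≤ |leftLimIn f a (r s) - u s₂| := fun e =>
    ((h.mono s m s₂ m₂ h23).resolve_left (not_lt.2 e.ge)).2
  have hL := fun t (ht : t ∈ Ioc a b) => hf.tendsto_leftLimIn ht
  have hneg : ∀ x y z : ℝ, x ∈ uIcc y z → -x ∈ uIcc (-y) (-z) := fun x y z hx => by
    rw [mem_uIcc] at hx ⊢; rcases hx with hx | hx
    · right; constructor <;> linarith [hx.1, hx.2]
    · left; constructor <;> linarith [hx.1, hx.2]
  have habs : ∀ x y : ℝ, |-x - -y| = |x - y| := fun x y => by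
    rw [← abs_neg]; congr 1; ring
  refine max_le ?_ ?_
  · exact sub_max_le_oscM hL (leftLimIn_self f a) hB g₁.1.1 (h.monotoneOn_fst m₁ m h12)
      (h.monotoneOn_fst m m₂ h23) g₂.1.2 g₁.2 g.2 g₂.2 o₁ o₂ hδ
  · have := sub_max_le_oscM (f := fun t => - f t) (L := fun t => - leftLimIn f a t)
      (fun t ht => (hL t ht).neg) (by simp [leftLimIn_self]) (B := B)
      (fun t ht => by rw [abs_neg]; exact hB t ht) g₁.1.1 (h.monotoneOn_fst m₁ m h12)
      (h.monotoneOn_fst m m₂ h23) g₂.1.2 (hneg _ _ _ g₁.2) (hneg _ _ _ g.2) (hneg _ _ _ g₂.2)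
      (fun e => by simpa only [habs] using o₁ e) (fun e => by simpa only [habs] using o₂ e) hδ
    rw [oscM_neg, max_neg_neg] at this
    linarith

lemma comp (h : IsParamRep f a b r u) {l : ℝ → ℝ} (hl : Continuous l) (hm : Monotone l)
    (h0 : l 0 = 0) (h1 : l 1 = 1) : IsParamRep f a b (fun x => r (l x)) (fun x => u (l x)) := by
  have hmaps : ∀ x ∈ Icc (0 : ℝ) 1, l x ∈ Icc (0 : ℝ) 1 := fun x hx =>
    ⟨h0 ▸ hm hx.1, h1 ▸ hm hx.2⟩
  refine ⟨h.contOn.comp hl.continuousOn hmaps, fun s hs => h.mem _ (hmaps s hs), fun p hp => ?_,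
    fun s hs s' hs' hss => h.mono _ (hmaps s hs) _ (hmaps s' hs') (hm hss), ?_, ?_⟩
  · obtain ⟨s, hs, he⟩ := h.surj p hp
    have := intermediate_value_Icc zero_le_one hl.continuousOn
    rw [h0, h1] at this
    obtain ⟨x, hx, rfl⟩ := this hs
    exact ⟨x, hx, he⟩
  · rw [h0]; exact h.init
  · rw [h1]; exact h.last

/-- Along a parametric representation, points with close times are nearly monotone. -/
lemma exists_modulus (h : IsParamRep f a b r u) {ε : ℝ} (hε : 0 < ε) : ∃ δ > 0, ∀ s₁ s s₂,
    0 ≤ s₁ → s₁ ≤ s → s ≤ s₂ → s₂ ≤ 1 → r s₂ - r s₁ < δ →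
      exceed (u s₁) (u s) (u s₂) < ε := by
  set I : Set (ℝ × ℝ × ℝ) := Icc 0 1 ×ˢ Icc 0 1 ×ˢ Icc 0 1 with hI
  have hIc : IsCompact I := isCompact_Icc.prod (isCompact_Icc.prod isCompact_Icc)
  have hE : ContinuousOn (fun p : ℝ × ℝ × ℝ => exceed (u p.1) (u p.2.1) (u p.2.2)) I := by
    refine continuous_exceed.comp_continuousOn (ContinuousOn.prodMk ?_ (ContinuousOn.prodMk ?_ ?_))
    · exact h.continuousOn_snd.comp (by fun_prop) fun p hp => hp.1
    · exact h.continuousOn_snd.comp (by fun_prop) fun p hp => hp.2.1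
    · exact h.continuousOn_snd.comp (by fun_prop) fun p hp => hp.2.2
  have hR : ContinuousOn (fun p : ℝ × ℝ × ℝ => r p.2.2 - r p.1) I := by
    refine ContinuousOn.sub ?_ ?_
    · exact h.continuousOn_fst.comp (by fun_prop) fun p hp => hp.2.2
    · exact h.continuousOn_fst.comp (by fun_prop) fun p hp => hp.1
  set K : Set (ℝ × ℝ × ℝ) :=
    (I ∩ (fun p : ℝ × ℝ × ℝ => exceed (u p.1) (u p.2.1) (u p.2.2)) ⁻¹' Ici ε) ∩
      {p | p.1 ≤ p.2.1 ∧ p.2.1 ≤ p.2.2} with hK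
  have hKc : IsCompact K := by
    refine IsCompact.inter_right (hIc.of_isClosed_subset
      (hE.preimage_isClosed_of_isClosed hIc.isClosed isClosed_Ici) inter_subset_left) ?_
    have c₁ : Continuous fun p : ℝ × ℝ × ℝ => p.1 := by fun_prop
    have c₂ : Continuous fun p : ℝ × ℝ × ℝ => p.2.1 := by fun_prop
    have c₃ : Continuous fun p : ℝ × ℝ × ℝ => p.2.2 := by fun_prop
    exact (isClosed_le c₁ c₂).inter (isClosed_le c₂ c₃)
  have hpos : ∀ p ∈ K, 0 < r p.2.2 - r p.1 := by
    rintro ⟨x, y, z⟩ ⟨⟨⟨hx, hy, hz⟩, hxyz⟩, hxy, hyz⟩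
    simp only [mem_preimage, mem_Ici] at hxyz hxy hyz hx hy hz ⊢
    have e1 := h.monotoneOn_fst hx hy hxy
    have e2 := h.monotoneOn_fst hy hz hyz
    by_contra hcon
    have e3 : r x = r y := by linarith
    have e4 : r y = r z := by linarith
    have o₁ := ((h.mono x hx y hy hxy).resolve_left (not_lt.2 e3.ge)).2
    have o₂ := ((h.mono y hy z hz hyz).resolve_left (not_lt.2 e4.ge)).2
    have g₁ := (mem_extGraph_iff.1 (h.mem x hx)).2
    have g := (mem_extGraph_iff.1 (h.mem y hy)).2
    have g₂ := (mem_extGraph_iff.1 (h.mem z hz)).2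
    simp only [Real.norm_eq_abs] at o₁ o₂
    rw [e3] at o₁ g₁
    rw [← e4] at g₂
    have : exceed (u x) (u y) (u z) ≤ 0 := by
      rw [exceed_le_iff]
      rcases le_total (leftLimIn f a (r y)) (f (r y)) with h' | h'
      · rw [uIcc_of_le h'] at g₁ g g₂
        rw [abs_of_nonpos (by linarith [g₁.1]), abs_of_nonpos (by linarith [g.1])] at o₁
        rw [abs_of_nonpos (by linarith [g.1]), abs_of_nonpos (by linarith [g₂.1])] at o₂
        constructor
        · linarith [le_max_right (u x) (u z)]
        · linarith [min_le_left (u x) (u z)]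
      · rw [uIcc_of_ge h'] at g₁ g g₂
        rw [abs_of_nonneg (by linarith [g₁.2]), abs_of_nonneg (by linarith [g.2])] at o₁
        rw [abs_of_nonneg (by linarith [g.2]), abs_of_nonneg (by linarith [g₂.2])] at o₂
        constructor
        · linarith [le_max_left (u x) (u z)]
        · linarith [min_le_right (u x) (u z)]
    linarith
  obtain ⟨δ, hδ, hδK⟩ : ∃ δ > 0, ∀ p ∈ K, δ ≤ r p.2.2 - r p.1 := by
    rcases K.eq_empty_or_nonempty with h0 | h0
    · exact ⟨1, one_pos, by simp [h0]⟩
    · obtain ⟨p, hp, hmin⟩ := hKc.exists_isMinOn h0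
        (hR.mono (inter_subset_left.trans inter_subset_left))
      exact ⟨_, hpos p hp, fun q hq => hmin hq⟩
  refine ⟨δ, hδ, fun s₁ s s₂ h1 h12 h23 h3 hr => ?_⟩
  by_contra! hcon
  exact absurd (hδK (s₁, s, s₂) ⟨⟨⟨⟨h1, by dsimp; linarith⟩, ⟨by dsimp; linarith, by dsimp; linarith⟩,
    ⟨by dsimp; linarith, h3⟩⟩, hcon⟩, h12, h23⟩) (not_le.2 hr)

/-- The excess of a function over short times tends to zero. -/
lemma exists_modulus_times (h : IsParamRep f a b r u) {ε : ℝ} (hε : 0 < ε) :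
    ∃ δ > 0, ∀ t₁ t t₂, a ≤ t₁ → t₁ < t → t < t₂ → t₂ ≤ b → t₂ - t₁ < δ →
      exceed (f t₁) (f t) (f t₂) < ε := by
  obtain ⟨δ, hδ, H⟩ := h.exists_modulus hε
  refine ⟨δ, hδ, fun t₁ t t₂ h1 h12 h23 h3 hr => ?_⟩
  obtain ⟨s₁, m₁, e₁⟩ := h.surj _ (mem_extGraph_self (f := f) (t := t₁) (a := a) (b := b)
    ⟨by linarith, by linarith⟩)
  obtain ⟨s, m, e⟩ := h.surj _ (mem_extGraph_self (f := f) (t := t) (a := a) (b := b)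
    ⟨by linarith, by linarith⟩)
  obtain ⟨s₂, m₂, e₂⟩ := h.surj _ (mem_extGraph_self (f := f) (t := t₂) (a := a) (b := b)
    ⟨by linarith, by linarith⟩)
  obtain ⟨r₁, u₁⟩ := Prod.mk.inj e₁
  obtain ⟨r', u'⟩ := Prod.mk.inj e
  obtain ⟨r₂, u₂⟩ := Prod.mk.inj e₂
  rw [← u₁, ← u', ← u₂]
  have hlt : ∀ x ∈ Icc (0:ℝ) 1, ∀ y ∈ Icc (0:ℝ) 1, r x < r y → x ≤ y := fun x hx y hy hxy => by
    by_contra! hc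
    exact absurd (h.monotoneOn_fst hy hx hc.le) (not_le.2 hxy)
  exact H s₁ s s₂ m₁.1 (hlt _ m₁ _ m (by linarith)) (hlt _ m _ m₂ (by linarith)) m₂.2
    (by linarith)

end IsParamRep

lemma countable_setOf_leftLim_lt {f L : ℝ → ℝ} {a b : ℝ}
    (hL : ∀ t ∈ Ioc a b, Tendsto f (𝓝[<] t) (𝓝 (L t))) :
    {t | t ∈ Ioc a b ∧ L t < f t}.Countable := by
  have : {t | t ∈ Ioc a b ∧ L t < f t} ⊆
      ⋃ p : ℚ × ℚ, {t | (p.1 : ℝ) < t ∧ (p.2 : ℝ) < f t ∧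
        ∀ s ∈ Ioo (p.1 : ℝ) t, f s < p.2} := by
    rintro t ⟨ht, hlt⟩
    obtain ⟨c, hc1, hc2⟩ := exists_rat_btwn hlt
    obtain ⟨l, hl, hl'⟩ := mem_nhdsLT_iff_exists_Ioo_subset.1
      ((hL t ht).eventually (gt_mem_nhds hc1))
    obtain ⟨q, hq1, hq2⟩ := exists_rat_btwn (mem_Iio.1 hl)
    exact mem_iUnion.2 ⟨(q, c), hq2, hc2, fun s hs => hl' ⟨hq1.trans hs.1, hs.2⟩⟩
  refine (countable_iUnion fun p => Set.Subsingleton.countable ?_).mono this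
  rintro t ⟨h1, h2, h3⟩ t' ⟨h1', h2', h3'⟩
  rcases lt_trichotomy t t' with h | h | h
  · exact absurd (h3' t ⟨h1, h⟩) (not_lt.2 h2.le)
  · exact h
  · exact absurd (h3 t' ⟨h1', h⟩) (not_lt.2 h2'.le)

lemma IsCadlagOn.countable_jumps {f : ℝ → ℝ} {a b : ℝ} (hf : IsCadlagOn f a b) :
    {t | t ∈ Ioc a b ∧ leftLimIn f a t ≠ f t}.Countable := by
  have h1 := countable_setOf_leftLim_lt fun t ht => hf.tendsto_leftLimIn (t := t) ht
  have h2 := countable_setOf_leftLim_lt fun t ht => (hf.tendsto_leftLimIn (t := t) ht).neg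
  refine (h1.union h2).mono ?_
  rintro t ⟨ht, hne⟩
  rcases lt_or_gt_of_ne hne with h | h
  · exact Or.inl ⟨ht, h⟩
  · exact Or.inr ⟨ht, neg_lt_neg h⟩

/-- There is an expanding function jumping at every point of a given countable set. -/
lemma exists_expanding_jumps {J : Set ℝ} (hJ : J.Countable) :
    ∃ σ : ℝ → ℝ, (∀ x y, x ≤ y → y - x ≤ σ y - σ x) ∧
      ∀ t ∈ J, Function.leftLim σ t < Function.rightLim σ t := by
  rcases J.eq_empty_or_nonempty with rfl | hne
  · exact ⟨id, fun x y _ => le_rfl, by simp⟩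
  obtain ⟨d, rfl⟩ := hJ.exists_eq_range hne
  set g : ℝ → ℕ → ℝ := fun t n => if d n ≤ t then (1 / 2 : ℝ) ^ n else 0 with hg
  have hgs : ∀ t, Summable (g t) := fun t =>
    Summable.of_nonneg_of_le (fun n => by simp only [hg]; split_ifs <;> positivity)
      (fun n => by simp only [hg]; split_ifs <;> first | exact le_rfl | positivity)
      summable_geometric_two
  have hgm : ∀ x y, x ≤ y → ∀ n, g x n ≤ g y n := fun x y hxy n => by
    simp only [hg]
    by_cases h : d n ≤ x
    · rw [if_pos h, if_pos (h.trans hxy)]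
    · rw [if_neg h]; split_ifs <;> positivity
  have hexp : ∀ x y, x ≤ y → y - x ≤ (y + ∑' n, g y n) - (x + ∑' n, g x n) := fun x y hxy => by
    have := (hgs x).tsum_le_tsum (hgm x y hxy) (hgs y)
    linarith
  refine ⟨fun t => t + ∑' n, g t n, hexp, ?_⟩
  rintro _ ⟨n, rfl⟩
  have hmono : Monotone fun t => t + ∑' n, g t n := fun x y hxy => by
    have := hexp x y hxy
    dsimp only; linarith
  have hjump : ∀ x < d n, (x + ∑' m, g x m) ≤ (d n + ∑' m, g (d n) m) - (1 / 2) ^ n := by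
    intro x hx
    have h1 : Summable fun m => if m = n then (1 / 2 : ℝ) ^ n else 0 :=
      (hasSum_ite_eq n _).summable
    have h2 := ((hgs x).add h1).tsum_le_tsum (g := g (d n)) (fun m => ?_) (hgs _)
    · rw [(hgs x).tsum_add h1, tsum_ite_eq] at h2
      linarith
    · by_cases h : m = n
      · subst h
        simp [hg, not_le.2 hx]
      · simpa [h] using hgm x (d n) hx.le m
  refine lt_of_lt_of_le ?_ (hmono.le_rightLim le_rfl)
  have : Function.leftLim (fun t => t + ∑' n, g t n) (d n) ≤
      (d n + ∑' m, g (d n) m) - (1 / 2) ^ n := by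
    refine le_of_tendsto (hmono.tendsto_leftLim (d n)) ?_
    filter_upwards [self_mem_nhdsWithin] with x hx using hjump x hx
  have : (0 : ℝ) < (1 / 2) ^ n := by positivity
  linarith

lemma abs_sub_le_of_mem_uIcc {x y z c ε : ℝ} (hx : x ∈ uIcc y z) (hy : |y - c| ≤ ε)
    (hz : |z - c| ≤ ε) : |x - c| ≤ ε := by
  rw [abs_le] at *
  rw [mem_uIcc] at hx
  rcases hx with hx | hx <;> constructor <;> linarith [hx.1, hx.2]

/-- Every real càdlàg function has a parametric representation. -/
lemma IsCadlagOn.exists_isParamRep {f : ℝ → ℝ} {a b : ℝ} (hab : a < b) (hf : IsCadlagOn f a b) :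
    ∃ r u, IsParamRep f a b r u := by
  obtain ⟨σ, hσ, hJ⟩ := exists_expanding_jumps hf.countable_jumps
  have hmono : Monotone σ := fun x y hxy => by linarith [hσ x y hxy]
  set l := Function.leftLim σ with hl
  set ρ := Function.rightLim σ with hρ
  set L := leftLimIn f a with hLdef
  have hL : ∀ t ∈ Ioc a b, Tendsto f (𝓝[<] t) (𝓝 (L t)) := fun t ht => hf.tendsto_leftLimIn ht
  have hLa : L a = f a := leftLimIn_self f a
  have hlρ : ∀ t, l t ≤ ρ t := fun t => hmono.leftLim_le_rightLim le_rfl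
  have hgap : ∀ t t', t < t' → ρ t + (t' - t) ≤ l t' := by
    intro t t' htt
    refine le_of_forall_pos_le_add fun ε hε => ?_
    set η := min (ε / 2) ((t' - t) / 2)
    have e1 : η ≤ ε / 2 := min_le_left _ _
    have e2 : η ≤ (t' - t) / 2 := min_le_right _ _
    have e3 : 0 < η := lt_min (by linarith) (by linarith)
    have e4 : ρ t ≤ σ (t + η) := hmono.rightLim_le (by linarith)
    have e5 : σ (t' - η) ≤ l t' := hmono.le_leftLim (by linarith)
    have e6 := hσ (t + η) (t' - η) (by linarith)
    linarith
  have hnojump : ∀ t ∈ Icc a b, l t = ρ t → L t = f t := by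
    intro t ht hlr
    rcases ht.1.eq_or_lt with rfl | h
    · exact hLa
    · by_contra hne
      exact (hJ t ⟨⟨h, ht.2⟩, hne⟩).ne hlr
  set A := l a with hA
  set B := ρ b with hB
  have hAB : A < B := by linarith [hgap a b hab, hlρ a, hlρ b]
  have hex : ∀ s, ∃ t, s ∈ Icc A B → t ∈ Icc a b ∧ l t ≤ s ∧ s ≤ ρ t := by
    intro s
    by_cases hs : s ∈ Icc A B
    swap
    · exact ⟨0, fun h => absurd h hs⟩
    set S := {t | t ∈ Icc a b ∧ l t ≤ s} with hS
    have haS : a ∈ S := ⟨⟨le_rfl, hab.le⟩, hs.1⟩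
    have hbd : BddAbove S := ⟨b, fun t ht => ht.1.2⟩
    have ht1 : a ≤ sSup S := le_csSup hbd haS
    have ht2 : sSup S ≤ b := csSup_le ⟨a, haS⟩ fun t ht => ht.1.2
    refine ⟨sSup S, fun _ => ⟨⟨ht1, ht2⟩, ?_, ?_⟩⟩
    · refine le_of_tendsto (hmono.tendsto_leftLim _) ?_
      filter_upwards [self_mem_nhdsWithin] with x hx
      obtain ⟨t, ht, hxt⟩ := exists_lt_of_lt_csSup ⟨a, haS⟩ (mem_Iio.1 hx)
      exact (hmono.le_leftLim hxt).trans ht.2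
    · rcases ht2.eq_or_lt with h | h
      · rw [h]; exact hs.2
      · refine ge_of_tendsto (hmono.tendsto_rightLim _) ?_
        filter_upwards [Ioo_mem_nhdsGT h] with x hx
        by_contra! hcon
        have : x ∈ S := ⟨⟨ht1.trans hx.1.le, hx.2.le⟩, (hmono.leftLim_le le_rfl).trans hcon.le⟩
        exact absurd (le_csSup hbd this) (not_le.2 hx.1)
  choose r hr using hex
  have hcmp : ∀ s t s' t', s ≤ s' → l t ≤ s → s' ≤ ρ t' → t ≤ t' := by
    intro s t s' t' hss h1 h2
    by_contra! hcon
    linarith [hgap t' t hcon]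
  have hlen : ∀ s t s' t', s ≤ s' → s ≤ ρ t → l t' ≤ s' → t' - t ≤ s' - s := by
    intro s t s' t' hss h1 h2
    rcases lt_or_ge t t' with h | h
    · linarith [hgap t t' h]
    · linarith
  have huniq : ∀ s ∈ Icc A B, ∀ t, l t ≤ s → s ≤ ρ t → r s = t := by
    intro s hs t h1 h2
    obtain ⟨-, h3, h4⟩ := hr s hs
    exact le_antisymm (hcmp s _ s _ le_rfl h3 h2) (hcmp s _ s _ le_rfl h1 h4)
  set w : ℝ → ℝ := fun s => (s - l (r s)) / (ρ (r s) - l (r s)) with hw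
  set u : ℝ → ℝ := fun s => L (r s) + w s * (f (r s) - L (r s)) with hu
  have hw01 : ∀ s ∈ Icc A B, 0 ≤ w s ∧ w s ≤ 1 := by
    intro s hs
    obtain ⟨-, h3, h4⟩ := hr s hs
    exact ⟨div_nonneg (by linarith) (by linarith), div_le_one_of_le₀ (by linarith) (by linarith)⟩
  have hus : ∀ s ∈ Icc A B, u s ∈ uIcc (L (r s)) (f (r s)) := by
    intro s hs
    obtain ⟨h0, h1⟩ := hw01 s hs
    rw [← segment_eq_uIcc]
    refine ⟨1 - w s, w s, by linarith, h0, by ring, ?_⟩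
    simp only [hu, smul_eq_mul]; ring
  have huR : ∀ s ∈ Icc A B, s = ρ (r s) → u s = f (r s) := by
    intro s hs h
    rcases (hlρ (r s)).eq_or_lt with h' | h'
    · simp only [hu, hnojump _ (hr s hs).1 h']; ring
    · have : w s = 1 := by simp only [hw]; rw [← h]; exact div_self (by linarith)
      simp only [hu, this]; ring
  have huL : ∀ s, s = l (r s) → u s = L (r s) := by
    intro s h
    have : w s = 0 := by simp only [hw]; rw [← h]; simp
    simp only [hu, this]; ring
  have haff : ∀ t, Continuous fun s => L t + (s - l t) / (ρ t - l t) * (f t - L t) := fun t => by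
    fun_prop
  have hrc : ContinuousOn r (Icc A B) := by
    have : LipschitzOnWith 1 r (Icc A B) := by
      refine LipschitzOnWith.of_dist_le_mul fun s hs s' hs' => ?_
      rw [NNReal.coe_one, one_mul, Real.dist_eq, Real.dist_eq]
      obtain ⟨-, h1, h2⟩ := hr s hs
      obtain ⟨-, h3, h4⟩ := hr s' hs'
      rcases le_total s s' with h | h
      · have e1 := hcmp _ _ _ _ h h1 h4
        have e2 := hlen _ _ _ _ h h2 h3
        rw [abs_of_nonpos (by linarith), abs_of_nonpos (by linarith)]; linarith
      · have e1 := hcmp _ _ _ _ h h3 h2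
        have e2 := hlen _ _ _ _ h h4 h1
        rw [abs_of_nonneg (by linarith), abs_of_nonneg (by linarith)]; linarith
    exact this.continuousOn
  have huright : ∀ s ∈ Icc A B, ContinuousWithinAt u (Icc s B) s := by
    intro s hs
    obtain ⟨ht, h1, h2⟩ := hr s hs
    rcases h2.lt_or_eq with h | h
    · refine ((haff (r s)).continuousWithinAt).congr_of_eventuallyEq ?_ (by simp only [hu, hw])
      filter_upwards [self_mem_nhdsWithin, mem_nhdsWithin_of_mem_nhds (gt_mem_nhds h)] with s' hs' hlt
      have := huniq s' ⟨hs.1.trans hs'.1, hs'.2⟩ (r s) (h1.trans hs'.1) (le_of_lt hlt)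
      simp only [hu, hw, this]
    · rcases ht.2.eq_or_lt with htb | htb
      · have : Icc s B = {s} := by rw [h, htb]; exact Icc_self _
        rw [this]; exact continuousWithinAt_singleton
      rw [Metric.continuousWithinAt_iff]
      intro ε hε
      have hc := (hf.1 (r s) ⟨ht.1, htb⟩).eventually (Metric.closedBall_mem_nhds _ (half_pos hε))
      rw [nhdsWithin_Ioc_eq_nhdsGT htb] at hc
      obtain ⟨t₁, ht₁, hsub⟩ := mem_nhdsGT_iff_exists_Ioo_subset.1 hc
      have hnear : ∀ x ∈ Ioo (r s) t₁, |f x - f (r s)| ≤ ε / 2 := fun x hx => hsub hx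
      refine ⟨t₁ - r s, sub_pos.2 ht₁, fun s' hs' hd => ?_⟩
      rw [Real.dist_eq] at hd ⊢
      rcases hs'.1.eq_or_lt with rfl | hlt
      · simpa using hε
      rw [abs_of_pos (by linarith)] at hd
      have hs'm : s' ∈ Icc A B := ⟨hs.1.trans hs'.1, hs'.2⟩
      obtain ⟨ht', h1', h2'⟩ := hr s' hs'm
      have hle := hcmp _ _ _ _ hs'.1 h1 h2'
      have hne : r s ≠ r s' := fun e => by rw [← e] at h2'; linarith
      have hlt' : r s < r s' := lt_of_le_of_ne hle hne
      have hlt₁ : r s' < t₁ := by linarith [hlen _ _ _ _ hs'.1 h2 h1']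
      have hLn : |L (r s') - f (r s)| ≤ ε / 2 := by
        have hLt := ((hL (r s') ⟨by linarith [ht.1], ht'.2⟩).sub_const (f (r s))).abs
        refine le_of_tendsto hLt ?_
        filter_upwards [Ioo_mem_nhdsLT hlt'] with x hx using hnear x ⟨hx.1, hx.2.trans hlt₁⟩
      have := abs_sub_le_of_mem_uIcc (hus s' hs'm) hLn (hnear _ ⟨hlt', hlt₁⟩)
      rw [huR s hs h]
      linarith
  have huleft : ∀ s ∈ Icc A B, ContinuousWithinAt u (Icc A s) s := by
    intro s hs
    obtain ⟨ht, h1, h2⟩ := hr s hs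
    rcases h1.lt_or_eq with h | h
    · refine ((haff (r s)).continuousWithinAt).congr_of_eventuallyEq ?_ (by simp only [hu, hw])
      filter_upwards [self_mem_nhdsWithin, mem_nhdsWithin_of_mem_nhds (lt_mem_nhds h)] with s' hs' hlt
      have := huniq s' ⟨hs'.1, hs'.2.trans hs.2⟩ (r s) (le_of_lt hlt) (hs'.2.trans h2)
      simp only [hu, hw, this]
    · rcases ht.1.eq_or_lt with hta | hta
      · have : Icc A s = {s} := by rw [← h, ← hta]; exact Icc_self _
        rw [this]; exact continuousWithinAt_singleton
      rw [Metric.continuousWithinAt_iff]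
      intro ε hε
      have hc := (hL (r s) ⟨hta, ht.2⟩).eventually (Metric.closedBall_mem_nhds _ (half_pos hε))
      obtain ⟨t₁, ht₁, hsub⟩ := mem_nhdsLT_iff_exists_Ioo_subset.1 hc
      have hnear : ∀ x ∈ Ioo t₁ (r s), |f x - L (r s)| ≤ ε / 2 := fun x hx => hsub hx
      refine ⟨r s - t₁, sub_pos.2 ht₁, fun s' hs' hd => ?_⟩
      rw [Real.dist_eq] at hd ⊢
      rcases hs'.2.eq_or_lt with rfl | hlt
      · simpa using hε
      rw [abs_of_neg (by linarith)] at hd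
      have hs'm : s' ∈ Icc A B := ⟨hs'.1, hs'.2.trans hs.2⟩
      obtain ⟨ht', h1', h2'⟩ := hr s' hs'm
      have hle := hcmp _ _ _ _ hs'.2 h1' h2
      have hne : r s' ≠ r s := fun e => by rw [e] at h1'; linarith
      have hlt' : r s' < r s := lt_of_le_of_ne hle hne
      have hlt₁ : t₁ < r s' := by linarith [hlen _ _ _ _ hs'.2 h2' h1]
      have hfn := hnear _ ⟨hlt₁, hlt'⟩
      have hLn : |L (r s') - L (r s)| ≤ ε / 2 := by
        rcases ht'.1.eq_or_lt with e | e
        · rw [← e, hLa, e]; exact hfn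
        have hLt := ((hL (r s') ⟨e, ht'.2⟩).sub_const (L (r s))).abs
        refine le_of_tendsto hLt ?_
        filter_upwards [Ioo_mem_nhdsLT hlt₁] with x hx using hnear x ⟨hx.1, hx.2.trans hlt'⟩
      have := abs_sub_le_of_mem_uIcc (hus s' hs'm) hLn hfn
      rw [huL s h.symm]
      linarith
  have huc : ContinuousOn u (Icc A B) := by
    intro s hs
    rw [← Icc_union_Icc_eq_Icc hs.1 hs.2]
    exact (huleft s hs).union (huright s hs)
  set φ : ℝ → ℝ := fun x => A + x * (B - A) with hφ
  have hφc : Continuous φ := by simp only [hφ]; fun_prop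
  have hφm : ∀ x ∈ Icc (0 : ℝ) 1, φ x ∈ Icc A B := fun x hx => by
    simp only [hφ]
    constructor <;> nlinarith [hx.1, hx.2]
  have hAm : A ∈ Icc A B := ⟨le_rfl, hAB.le⟩
  have hBm : B ∈ Icc A B := ⟨hAB.le, le_rfl⟩
  have hrA : r A = a := huniq A hAm a le_rfl (hlρ a)
  have hrB : r B = b := huniq B hBm b (hlρ b) le_rfl
  refine ⟨fun x => r (φ x), fun x => u (φ x), ⟨?_, ?_, ?_, ?_, ?_, ?_⟩⟩
  · exact (hrc.comp hφc.continuousOn hφm).prodMk (huc.comp hφc.continuousOn hφm)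
  · exact fun x hx => mem_extGraph_iff.2 ⟨(hr _ (hφm x hx)).1, hus _ (hφm x hx)⟩
  · rintro ⟨t, v⟩ ⟨ht, α, hα, hv⟩
    dsimp only at ht hv
    have e0 := hlρ t
    have e1 : A ≤ l t := hmono.leftLim ht.1
    have e2 : ρ t ≤ B := hmono.rightLim ht.2
    obtain ⟨s, hs⟩ : ∃ s, s = l t + (1 - α) * (ρ t - l t) := ⟨_, rfl⟩
    have hs1 : l t ≤ s := by nlinarith [hα.1, hα.2]
    have hs2 : s ≤ ρ t := by nlinarith [hα.1, hα.2]
    have hsm : s ∈ Icc A B := ⟨e1.trans hs1, hs2.trans e2⟩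
    have hrs := huniq s hsm t hs1 hs2
    refine ⟨(s - A) / (B - A), ⟨div_nonneg (by linarith) (by linarith),
      div_le_one_of_le₀ (by linarith [hsm.2]) (by linarith)⟩, ?_⟩
    have hφs : φ ((s - A) / (B - A)) = s := by
      simp only [hφ]; rw [div_mul_cancel₀ _ (by linarith)]; ring
    simp only [hφs, hrs, Prod.mk.injEq, true_and]
    simp only [hu, hw, hrs, hv, smul_eq_mul]
    rcases e0.eq_or_lt with e | e
    · rw [← hLdef, hnojump t ht e]; ring
    · rw [hs, add_sub_cancel_left, mul_div_cancel_right₀ _ (by linarith)]; ring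
  · intro x hx y hy hxy
    have hss : φ x ≤ φ y := by simp only [hφ]; nlinarith
    obtain ⟨-, h1, h2⟩ := hr _ (hφm x hx)
    obtain ⟨-, h3, h4⟩ := hr _ (hφm y hy)
    rcases (hcmp _ _ _ _ hss h1 h4).lt_or_eq with h | h
    · exact Or.inl h
    · refine Or.inr ⟨h, ?_⟩
      have hwle : w (φ x) ≤ w (φ y) := by
        simp only [hw, h]
        exact div_le_div_of_nonneg_right (by linarith) (by linarith [hlρ (r (φ y))])
      have key : ∀ s, L (r s) - u s = - (w s * (f (r s) - L (r s))) := fun s => by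
        simp only [hu]; ring
      have key' : ‖L (r (φ x)) - u (φ x)‖ ≤ ‖L (r (φ y)) - u (φ y)‖ := by
        rw [key, key, norm_neg, norm_neg, norm_mul, norm_mul, ← h,
          Real.norm_of_nonneg (hw01 _ (hφm x hx)).1, Real.norm_of_nonneg (hw01 _ (hφm y hy)).1]
        exact mul_le_mul_of_nonneg_right hwle (norm_nonneg _)
      rwa [← h] at key' ⊢
  · have : φ 0 = A := by simp only [hφ]; ring
    simp only [this]
    refine ⟨hrA, ?_⟩
    rw [huL A (by rw [hrA]), hrA, hLa]
  · have : φ 1 = B := by simp only [hφ]; ring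
    simp only [this]
    refine ⟨hrB, ?_⟩
    rw [huR B hBm (by rw [hrB]), hrB]

lemma Align.mono {Q Q' : ℝ → ℝ → Prop} {a a' b b' : ℝ} (hQ : ∀ x y, Q x y → Q' x y)
    (h : Align Q a a' b b') : Align Q' a a' b b' := by
  obtain ⟨l, m, h1, h2, h3, h4, h5, h6, h7⟩ := h
  exact ⟨l, m, h1, h2, h3, h4, h5, h6, fun x => hQ _ _ (h7 x)⟩

lemma dM_nonneg (a b : ℝ) (f g : ℝ → ℝ) : 0 ≤ dM a b f g := by
  refine Real.sInf_nonneg ?_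
  rintro _ ⟨r₁, u₁, r₂, u₂, -, -, rfl⟩
  exact le_max_of_le_left (Real.iSup_nonneg fun _ => abs_nonneg _)

lemma dM_le {f g : ℝ → ℝ} {a b c : ℝ} {r₁ u₁ r₂ u₂ : ℝ → ℝ} (h₁ : IsParamRep f a b r₁ u₁)
    (h₂ : IsParamRep g a b r₂ u₂) (hr : ∀ s ∈ Icc (0 : ℝ) 1, |r₁ s - r₂ s| ≤ c)
    (hu : ∀ s ∈ Icc (0 : ℝ) 1, |u₁ s - u₂ s| ≤ c) : dM a b f g ≤ c := by
  have hc : 0 ≤ c := (abs_nonneg _).trans (hr 0 (by simp))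
  refine csInf_le_of_le ⟨0, ?_⟩ ⟨r₁, u₁, r₂, u₂, h₁, h₂, rfl⟩ ?_
  · rintro _ ⟨r₁, u₁, r₂, u₂, -, -, rfl⟩
    exact le_max_of_le_left (Real.iSup_nonneg fun _ => abs_nonneg _)
  · exact max_le (Real.iSup_le (fun s => hr s s.2) hc) (Real.iSup_le (fun s => hu s s.2) hc)

lemma bddAbove_range_of_continuousOn {φ : ℝ → ℝ} (h : ContinuousOn φ (Icc 0 1)) :
    BddAbove (range fun s : Icc (0 : ℝ) 1 => φ s.1) := by
  have : (range fun s : Icc (0 : ℝ) 1 => φ s.1) = φ '' Icc 0 1 := by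
    ext y; simp
  rw [this]
  exact (isCompact_Icc.image_of_continuousOn h).bddAbove

lemma exists_isParamRep_of_dM_lt {f g : ℝ → ℝ} {a b η : ℝ} (hab : a < b)
    (hf : IsCadlagOn f a b) (hg : IsCadlagOn g a b) (h : dM a b f g < η) :
    ∃ r₁ u₁ r₂ u₂, IsParamRep f a b r₁ u₁ ∧ IsParamRep g a b r₂ u₂ ∧
      ∀ s ∈ Icc (0 : ℝ) 1, |r₁ s - r₂ s| < η ∧ |u₁ s - u₂ s| < η := by
  obtain ⟨r, u, hru⟩ := hf.exists_isParamRep hab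
  obtain ⟨r', u', hru'⟩ := hg.exists_isParamRep hab
  unfold dM at h
  obtain ⟨_, ⟨r₁, u₁, r₂, u₂, h₁, h₂, rfl⟩, hlt⟩ :=
    exists_lt_of_csInf_lt (by exact ⟨_, r, u, r', u', hru, hru', rfl⟩) h
  refine ⟨r₁, u₁, r₂, u₂, h₁, h₂, fun s hs => ?_⟩
  obtain ⟨l1, l2⟩ := max_lt_iff.1 hlt
  constructor
  · exact (le_ciSup (f := fun s : Icc (0 : ℝ) 1 => |r₁ s.1 - r₂ s.1|)
      (bddAbove_range_of_continuousOn (φ := fun s => |r₁ s - r₂ s|)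
        (h₁.continuousOn_fst.sub h₂.continuousOn_fst).abs) ⟨s, hs⟩).trans_lt l1
  · exact (le_ciSup (f := fun s : Icc (0 : ℝ) 1 => ‖u₁ s.1 - u₂ s.1‖)
      (bddAbove_range_of_continuousOn (φ := fun s => |u₁ s - u₂ s|)
        (h₁.continuousOn_snd.sub h₂.continuousOn_snd).abs) ⟨s, hs⟩).trans_lt l2

namespace IsParamRep

variable {f : ℝ → ℝ} {a b : ℝ} {r u : ℝ → ℝ}

lemma exists_param (h : IsParamRep f a b r u) {t : ℝ} (ht : t ∈ Icc a b) :
    ∃ s ∈ Icc (0 : ℝ) 1, r s = t ∧ u s = f t := by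
  obtain ⟨s, hs, e⟩ := h.surj _ (mem_extGraph_self (f := f) ht)
  exact ⟨s, hs, Prod.mk.inj e⟩

lemma lt_of_fst_lt (h : IsParamRep f a b r u) {x y : ℝ} (hx : x ∈ Icc (0 : ℝ) 1)
    (hy : y ∈ Icc (0 : ℝ) 1) (hxy : r x < r y) : x < y := by
  by_contra! hc
  exact absurd (h.monotoneOn_fst hy hx hc) (not_le.2 hxy)

end IsParamRep

lemma oscM_le_of_dM_lt {f g : ℝ → ℝ} {a b η δ δ' : ℝ} (hab : a < b)
    (hf : IsCadlagOn f a b) (hg : IsCadlagOn g a b) (h : dM a b f g < η)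
    (hδ : δ + 2 * η ≤ δ') : oscM f a b δ ≤ oscM g a b δ' + 2 * η := by
  obtain ⟨r₁, u₁, r₂, u₂, h₁, h₂, hc⟩ := exists_isParamRep_of_dM_lt hab hf hg h
  have hη : 0 < η := (dM_nonneg a b f g).trans_lt h
  refine oscM_le (by linarith [oscM_nonneg g a b δ']) fun t₁ t t₂ k1 k2 k3 k4 k5 => ?_
  obtain ⟨s₁, m₁, e₁, e₁'⟩ := h₁.exists_param (t := t₁) ⟨k1, by linarith⟩
  obtain ⟨s, m, e, e'⟩ := h₁.exists_param (t := t) ⟨by linarith, by linarith⟩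
  obtain ⟨s₂, m₂, e₂, e₂'⟩ := h₁.exists_param (t := t₂) ⟨by linarith, k4⟩
  have l1 := h₁.lt_of_fst_lt m₁ m (by rw [e₁, e]; exact k2)
  have l2 := h₁.lt_of_fst_lt m m₂ (by rw [e₂, e]; exact k3)
  have c₁ := hc s₁ m₁
  have c₂ := hc s₂ m₂
  have c₁' := abs_lt.1 c₁.1
  have c₂' := abs_lt.1 c₂.1
  have := h₂.exceed_le_oscM hg m₁.1 l1.le l2.le m₂.2 (δ := δ') (by linarith)
  rw [← e₁', ← e', ← e₂']
  linarith [exceed_le_add c₁.2.le (hc s m).2.le c₂.2.le]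

lemma abs_sub_le_of_dM_lt_of_mem_Ioo {f g : ℝ → ℝ} {a b η δ t : ℝ} (hab : a < b)
    (hf : IsCadlagOn f a b) (hg : IsCadlagOn g a b) (h : dM a b f g < η)
    (ht₁ : a ≤ t - η) (ht₂ : t + η ≤ b) (hδ : 2 * η < δ) :
    |f t - g t| ≤ η + oscM g a b δ + |g (t - η) - g t| + |g (t + η) - g t| := by
  obtain ⟨r₁, u₁, r₂, u₂, h₁, h₂, hc⟩ := exists_isParamRep_of_dM_lt hab hf hg h
  have hη : 0 < η := (dM_nonneg a b f g).trans_lt h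
  obtain ⟨s, m, e, e'⟩ := h₁.exists_param (t := t) ⟨by linarith, by linarith⟩
  obtain ⟨s₁, m₁, e₁, e₁'⟩ := h₂.exists_param (t := t - η) ⟨by linarith, by linarith⟩
  obtain ⟨s₂, m₂, e₂, e₂'⟩ := h₂.exists_param (t := t + η) ⟨by linarith, by linarith⟩
  have c := hc s m
  have c1 := abs_lt.1 c.1
  have c2 := abs_lt.1 c.2
  have l1 := h₂.lt_of_fst_lt m₁ m (by linarith)
  have l2 := h₂.lt_of_fst_lt m m₂ (by linarith)
  obtain ⟨b1, b2⟩ := exceed_le_iff.1 <|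
    h₂.exceed_le_oscM hg m₁.1 l1.le l2.le m₂.2 (δ := δ) (by linarith)
  rw [e₁', e₂'] at b1 b2
  rw [e'] at c2
  have n1 := abs_nonneg (g (t - η) - g t)
  have n2 := abs_nonneg (g (t + η) - g t)
  have d1 := abs_le.1 (le_refl |g (t - η) - g t|)
  have d2 := abs_le.1 (le_refl |g (t + η) - g t|)
  rw [abs_le]
  constructor
  · rcases min_choice (g (t - η)) (g (t + η)) with hh | hh <;> rw [hh] at b2 <;> linarith
  · rcases max_choice (g (t - η)) (g (t + η)) with hh | hh <;> rw [hh] at b1 <;> linarith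

lemma abs_sub_le_of_dM_lt_of_endpoint {f g : ℝ → ℝ} {a b η t : ℝ} (hab : a < b)
    (hf : IsCadlagOn f a b) (hg : IsCadlagOn g a b) (h : dM a b f g < η)
    (ht : t = a ∨ t = b) : |f t - g t| < η := by
  obtain ⟨r₁, u₁, r₂, u₂, h₁, h₂, hc⟩ := exists_isParamRep_of_dM_lt hab hf hg h
  rcases ht with rfl | rfl
  · rw [← h₁.init.2, ← h₂.init.2]; exact (hc 0 (by simp)).2
  · rw [← h₁.last.2, ← h₂.last.2]; exact (hc 1 (by simp)).2

namespace IsParamRep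

variable {f : ℝ → ℝ} {a b : ℝ} {r u : ℝ → ℝ}

lemma exists_partition (h : IsParamRep f a b r u) (hab : a < b) {N : ℕ} (hN : 0 < N) :
    ∃ s : ℕ → ℝ, s 0 = 0 ∧ s N = 1 ∧ ∀ i ≤ N, s i ∈ Icc (0 : ℝ) 1 ∧
      r (s i) = a + i * ((b - a) / N) ∧ u (s i) = f (a + i * ((b - a) / N)) := by
  have hN' : (0 : ℝ) < N := by exact_mod_cast hN
  have : ∀ i : ℕ, ∃ x : ℝ, (i = 0 → x = 0) ∧ (i = N → x = 1) ∧ (i ≤ N → x ∈ Icc (0 : ℝ) 1 ∧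
      r x = a + i * ((b - a) / N) ∧ u x = f (a + i * ((b - a) / N))) := by
    intro i
    by_cases h0 : i = 0
    · subst h0
      exact ⟨0, fun _ => rfl, fun e => absurd e hN.ne, fun _ => by simpa using h.init⟩
    by_cases h1 : i = N
    · subst h1
      refine ⟨1, fun e => absurd e h0, fun _ => rfl, fun _ => ?_⟩
      rw [mul_div_cancel₀ _ hN'.ne', add_sub_cancel]
      exact ⟨by simp, h.last⟩
    by_cases h2 : i ≤ N
    · have hi : (i : ℝ) ≤ N := by exact_mod_cast h2
      obtain ⟨x, hx, e⟩ := h.exists_param (t := a + i * ((b - a) / N)) (by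
        have h3 : (0 : ℝ) ≤ (b - a) / N := div_nonneg (by linarith) hN'.le
        have h4 : (N : ℝ) * ((b - a) / N) = b - a := mul_div_cancel₀ _ hN'.ne'
        constructor
        · have : 0 ≤ (i : ℝ) * ((b - a) / N) := by positivity
          linarith
        · have := mul_le_mul_of_nonneg_right hi h3
          linarith)
      exact ⟨x, fun e => absurd e h0, fun e => absurd e h1, fun _ => ⟨hx, e⟩⟩
    · exact ⟨0, fun e => absurd e h0, fun e => absurd e h1, fun e => absurd e h2⟩
  choose s hs using this
  exact ⟨s, (hs 0).1 rfl, (hs N).2.1 rfl, fun i hi => (hs i).2.2 hi⟩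

lemma exists_extension (h : IsParamRep f a b r u) :
    ∃ p : ℝ → ℝ, Continuous p ∧ ∀ x ∈ Icc (0 : ℝ) 1, p x = u x :=
  ⟨IccExtend zero_le_one ((Icc (0 : ℝ) 1).domRestrict u),
    h.continuousOn_snd.domRestrict.Icc_extend', fun x hx => by rw [IccExtend_of_mem _ _ hx]; rfl⟩

end IsParamRep

/-- Two functions with small oscillation which are close on a fine grid are close for the `M₁`
metric. -/
lemma dM_le_of_grid {f g : ℝ → ℝ} {a b δ ε : ℝ} (hab : a < b) (hf : IsCadlagOn f a b)
    (hg : IsCadlagOn g a b) {N : ℕ} (hN : 0 < N) (hδ : (b - a) / N < δ) (hε : 0 < ε)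
    (hfo : oscM f a b δ ≤ ε) (hgo : oscM g a b δ ≤ ε)
    (hfg : ∀ i ≤ N, |f (a + i * ((b - a) / N)) - g (a + i * ((b - a) / N))| ≤ ε) :
    dM a b f g ≤ max ((b - a) / N) (9 * ε) := by
  obtain ⟨r, u, hru⟩ := hf.exists_isParamRep hab
  obtain ⟨r', u', hru'⟩ := hg.exists_isParamRep hab
  obtain ⟨s, s0, sN, hs⟩ := hru.exists_partition hab hN
  obtain ⟨s', s0', sN', hs'⟩ := hru'.exists_partition hab hN
  obtain ⟨p, hp, hpu⟩ := hru.exists_extension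
  obtain ⟨q, hq, hqu⟩ := hru'.exists_extension
  set h := (b - a) / N with hh
  have hh0 : 0 < h := div_pos (by linarith) (by exact_mod_cast hN)
  set Q : ℝ → ℝ → Prop := fun x y => |r x - r' y| ≤ max h (9 * ε) ∧
    |u x - u' y| ≤ max h (9 * ε) with hQ
  have hle : 9 * ε ≤ max h (9 * ε) := le_max_right _ _
  have hle' : h ≤ max h (9 * ε) := le_max_left _ _
  have key : ∀ i ≤ N, Align Q 0 0 (s i) (s' i) := by
    intro i
    induction i with
    | zero =>
      intro _
      obtain ⟨-, h1, h2⟩ := hs 0 hN.le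
      obtain ⟨-, h1', h2'⟩ := hs' 0 hN.le
      have := hfg 0 hN.le
      rw [s0, s0']
      rw [s0] at h1 h2
      rw [s0'] at h1' h2'
      refine Align.refl ⟨?_, ?_⟩
      · rw [h1, h1', sub_self, abs_zero]; linarith
      · rw [h2, h2']; linarith
    | succ i ih =>
      intro hi
      refine (ih (by omega)).trans ?_
      obtain ⟨m, h1, h2⟩ := hs i (by omega)
      obtain ⟨m', h1', h2'⟩ := hs' i (by omega)
      obtain ⟨n, k1, k2⟩ := hs (i + 1) hi
      obtain ⟨n', k1', k2'⟩ := hs' (i + 1) hi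
      push_cast at k1 k1'
      have l1 := hru.lt_of_fst_lt m n (by rw [h1, k1]; linarith)
      have l2 := hru'.lt_of_fst_lt m' n' (by rw [h1', k1']; linarith)
      have sub : ∀ {x}, s i ≤ x → x ≤ s (i + 1) → x ∈ Icc (0 : ℝ) 1 := fun h h' =>
        ⟨m.1.trans h, h'.trans n.2⟩
      have sub' : ∀ {x}, s' i ≤ x → x ≤ s' (i + 1) → x ∈ Icc (0 : ℝ) 1 := fun h h' =>
        ⟨m'.1.trans h, h'.trans n'.2⟩
      have tim : ∀ {x}, s i ≤ x → x ≤ s (i + 1) → a + i * h ≤ r x ∧ r x ≤ a + (i + 1) * h :=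
        fun h h' => ⟨h1 ▸ hru.monotoneOn_fst m (sub h h') h,
          k1 ▸ hru.monotoneOn_fst (sub h h') n h'⟩
      have tim' : ∀ {x}, s' i ≤ x → x ≤ s' (i + 1) →
          a + i * h ≤ r' x ∧ r' x ≤ a + (i + 1) * h :=
        fun h h' => ⟨h1' ▸ hru'.monotoneOn_fst m' (sub' h h') h,
          k1' ▸ hru'.monotoneOn_fst (sub' h h') n' h'⟩
      refine (align_of_exceed_le hp hq l1 l2 hε ?_ ?_ ?_ ?_).mono ?_
      · intro x y z hx hxy hyz hz
        have mx := sub hx (hxy.trans (hyz.trans hz))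
        have mz := sub (hx.trans (hxy.trans hyz)) hz
        rw [hpu x mx, hpu y (sub (hx.trans hxy) (hyz.trans hz)), hpu z mz]
        refine (hru.exceed_le_oscM hf mx.1 hxy hyz mz.2 ?_).trans hfo
        linarith [(tim hx (hxy.trans (hyz.trans hz))).1, (tim (hx.trans (hxy.trans hyz)) hz).2]
      · intro x y z hx hxy hyz hz
        have mx := sub' hx (hxy.trans (hyz.trans hz))
        have mz := sub' (hx.trans (hxy.trans hyz)) hz
        rw [hqu x mx, hqu y (sub' (hx.trans hxy) (hyz.trans hz)), hqu z mz]
        refine (hru'.exceed_le_oscM hg mx.1 hxy hyz mz.2 ?_).trans hgo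
        linarith [(tim' hx (hxy.trans (hyz.trans hz))).1, (tim' (hx.trans (hxy.trans hyz)) hz).2]
      · rw [hpu _ m, hqu _ m', h2, h2']; exact hfg i (by omega)
      · rw [hpu _ n, hqu _ n', k2, k2']; exact hfg (i + 1) hi
      · rintro x y ⟨hx, hy, hxy⟩
        rw [hpu x (sub hx.1 hx.2), hqu y (sub' hy.1 hy.2)] at hxy
        refine ⟨?_, hxy.trans hle⟩
        have := tim hx.1 hx.2
        have := tim' hy.1 hy.2
        rw [abs_le]
        constructor <;> linarith
  obtain ⟨l, m, hl, hm, hlm, hmm, z0, z1, hlQ⟩ := key N le_rfl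
  rw [sN, sN'] at z1
  exact dM_le (hru.comp hl hlm (z0 0 le_rfl).1 (z1 1 le_rfl).1)
    (hru'.comp hm hmm (z0 0 le_rfl).2 (z1 1 le_rfl).2)
    (fun x _ => (hlQ x).1) (fun x _ => (hlQ x).2)

open MeasureTheory

lemma IsCadlagOn.exceed_le_of_dense {f : ℝ → ℝ} {a b δ c : ℝ} (hf : IsCadlagOn f a b) {D : Set ℝ}
    (hD : Dense D) (hb : b ∈ D)
    (h : ∀ q₁ ∈ D, ∀ q ∈ D, ∀ q₂ ∈ D, a ≤ q₁ → q₁ < q → q < q₂ → q₂ ≤ b → q₂ - q₁ ≤ δ →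
      exceed (f q₁) (f q) (f q₂) ≤ c)
    {t₁ t t₂ : ℝ} (h1 : a ≤ t₁) (h2 : t₁ < t) (h3 : t < t₂) (h4 : t₂ ≤ b) (h5 : t₂ - t₁ < δ) :
    exceed (f t₁) (f t) (f t₂) ≤ c := by
  have key : ∀ s ∈ Icc a b, ∀ η > 0, ∀ κ > 0,
      ∃ q ∈ D, s ≤ q ∧ q < s + κ ∧ q ≤ b ∧ |f s - f q| ≤ η := by
    intro s hs η hη κ hκ
    rcases hs.2.eq_or_lt with rfl | hsb
    · exact ⟨s, hb, le_rfl, by linarith, le_rfl, by simpa using hη.le⟩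
    have e1 := (hf.1 s ⟨hs.1, hsb⟩).eventually (Metric.closedBall_mem_nhds (f s) hη)
    rw [nhdsWithin_Ioc_eq_nhdsGT hsb] at e1
    obtain ⟨u, hu, hu'⟩ := (mem_nhdsGT_iff_exists_Ioo_subset' hsb).1 e1
    obtain ⟨q, hq, hq'⟩ := hD.exists_between (lt_min (lt_min hu hsb) (by linarith : s < s + κ))
    rw [mem_Ioo, lt_min_iff, lt_min_iff] at hq'
    refine ⟨q, hq, hq'.1.le, hq'.2.2, hq'.2.1.2.le, ?_⟩
    rw [abs_sub_comm]
    exact hu' ⟨hq'.1, hq'.2.1.1⟩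
  refine le_of_forall_pos_le_add fun η hη => ?_
  set κ := min (min (t - t₁) (t₂ - t)) (δ - (t₂ - t₁)) with hκ
  have k0 : 0 < κ := lt_min (lt_min (by linarith) (by linarith)) (by linarith)
  have k1 : κ ≤ t - t₁ := (min_le_left _ _).trans (min_le_left _ _)
  have k2 : κ ≤ t₂ - t := (min_le_left _ _).trans (min_le_right _ _)
  have k3 : κ ≤ δ - (t₂ - t₁) := min_le_right _ _
  obtain ⟨q₁, d1, a1, b1, -, e1⟩ := key t₁ ⟨by linarith, by linarith⟩ (η / 2) (by linarith) κ k0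
  obtain ⟨q, d2, a2, b2, -, e2⟩ := key t ⟨by linarith, by linarith⟩ (η / 2) (by linarith) κ k0
  obtain ⟨q₂, d3, a3, b3, c3, e3⟩ := key t₂ ⟨by linarith, by linarith⟩ (η / 2) (by linarith) κ k0
  linarith [exceed_le_add e1 e2 e3, h q₁ d1 q d2 q₂ d3 (by linarith) (by linarith) (by linarith) c3
    (by linarith)]


section RealValued

variable {Ω : Type*} [MeasurableSpace Ω] {P : Measure Ω} {T : ℝ}

lemma tendsto_measure_le_oscM [IsFiniteMeasure P] (hT : 0 < T) {x : ℝ → Ω → ℝ}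
    (hx : ∀ t ∈ Icc 0 T, Measurable (x t)) (hcad : ∀ ω, IsCadlagOn (fun t => x t ω) 0 T)
    {ε : ℝ} (hε : 0 < ε) :
    Tendsto (fun δ => P {ω | ε ≤ oscM (fun t => x t ω) 0 T δ}) (𝓝[>] 0) (𝓝 0) := by
  set D : Set ℝ := range ((↑) : ℚ → ℝ) ∪ {T} with hD
  have hDc : D.Countable := (countable_range _).union (countable_singleton _)
  have hDd : Dense D := Rat.denseRange_cast.mono subset_union_left
  have hTD : T ∈ D := Or.inr rfl
  set S : ℕ → Set (ℝ × ℝ × ℝ) := fun m => {p | (p.1 ∈ D ∧ p.2.1 ∈ D ∧ p.2.2 ∈ D) ∧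
    0 ≤ p.1 ∧ p.1 < p.2.1 ∧ p.2.1 < p.2.2 ∧ p.2.2 ≤ T ∧ p.2.2 - p.1 ≤ 1 / ((m : ℝ) + 1)} with hS
  set A : ℕ → Set Ω := fun m => ⋃ p ∈ S m, {ω | ε / 2 < exceed (x p.1 ω) (x p.2.1 ω) (x p.2.2 ω)}
    with hA
  have hAm : ∀ m, MeasurableSet (A m) := by
    intro m
    have hc : (S m).Countable := by
      refine (hDc.prod (hDc.prod hDc)).mono ?_
      rintro p ⟨⟨h1, h2, h3⟩, -⟩
      exact ⟨h1, h2, h3⟩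
    refine MeasurableSet.biUnion hc ?_
    rintro p ⟨-, h1, h2, h3, h4, -⟩
    have := continuous_exceed.measurable.comp ((hx p.1 ⟨h1, by linarith⟩).prodMk
      ((hx p.2.1 ⟨by linarith, by linarith⟩).prodMk (hx p.2.2 ⟨by linarith, by linarith⟩)))
    exact measurableSet_lt measurable_const this
  have hanti : Antitone A := by
    intro m m' hmm
    refine biUnion_subset_biUnion_left ?_
    rintro p ⟨h0, h1, h2, h3, h4, h5⟩
    exact ⟨h0, h1, h2, h3, h4, h5.trans (Nat.one_div_le_one_div hmm)⟩
  have hinter : ⋂ m, A m = ∅ := by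
    refine eq_empty_of_forall_notMem fun ω hω => ?_
    obtain ⟨r, u, hru⟩ := (hcad ω).exists_isParamRep hT
    obtain ⟨δ, hδ, h⟩ := hru.exists_modulus_times (half_pos hε)
    obtain ⟨m, hm⟩ := exists_nat_one_div_lt hδ
    have := mem_iInter.1 hω m
    simp only [hA, mem_iUnion, exists_prop] at this
    obtain ⟨p, ⟨-, h1, h2, h3, h4, h5⟩, hp⟩ := this
    exact lt_asymm hp (h _ _ _ h1 h2 h3 h4 (h5.trans_lt hm))
  have hlim : Tendsto (fun m => P (A m)) atTop (𝓝 0) := by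
    have := tendsto_measure_iInter_atTop (μ := P) (fun m => (hAm m).nullMeasurableSet) hanti
      ⟨0, measure_ne_top _ _⟩
    rwa [hinter, measure_empty] at this
  rw [ENNReal.tendsto_nhds_zero] at hlim ⊢
  intro c hc
  obtain ⟨m, hm⟩ := (hlim c hc).exists
  filter_upwards [Ioo_mem_nhdsGT (Nat.one_div_pos_of_nat (α := ℝ) (n := m))] with δ hδ
  refine (measure_mono fun ω hω => ?_).trans hm
  by_contra hn
  simp only [hA, mem_iUnion, exists_prop, not_exists, not_and] at hn
  have : oscM (fun t => x t ω) 0 T δ ≤ ε / 2 := by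
    refine oscM_le (half_pos hε).le fun t₁ t t₂ h1 h2 h3 h4 h5 => ?_
    refine (hcad ω).exceed_le_of_dense hDd hTD ?_ h1 h2 h3 h4 (h5.trans_lt hδ.2)
    intro q₁ d1 q d2 q₂ d3 k1 k2 k3 k4 k5
    exact not_lt.1 (hn (q₁, q, q₂) ⟨⟨d1, d2, d3⟩, k1, k2, k3, k4, k5⟩)
  have h' : ε ≤ oscM (fun t => x t ω) 0 T δ := hω
  linarith

variable {x : ℝ → Ω → ℝ} {xn : ℕ → ℝ → Ω → ℝ}

lemma tendsto_limsup_measure_le_oscM_of_dM [IsFiniteMeasure P] (hT : 0 < T)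
    (hx : ∀ t ∈ Icc 0 T, Measurable (x t)) (hcad : ∀ ω, IsCadlagOn (fun t => x t ω) 0 T)
    (hcadn : ∀ n ω, IsCadlagOn (fun t => xn n t ω) 0 T)
    (h : ∀ ε > (0 : ℝ), Tendsto
      (fun n => P {ω | ε ≤ dM 0 T (fun t => xn n t ω) (fun t => x t ω)}) atTop (𝓝 0))
    {ε : ℝ} (hε : 0 < ε) :
    Tendsto (fun δ : ℝ => limsup (fun n => P {ω | ε ≤ oscM (fun t => xn n t ω) 0 T δ}) atTop)
      (𝓝[>] 0) (𝓝 0) := by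
  have h3 : Tendsto (fun δ : ℝ => 3 * δ) (𝓝[>] 0) (𝓝[>] 0) := by
    refine tendsto_nhdsWithin_iff.2 ⟨?_, ?_⟩
    · have : Continuous fun δ : ℝ => 3 * δ := by fun_prop
      simpa using (this.tendsto 0).mono_left nhdsWithin_le_nhds
    · filter_upwards [self_mem_nhdsWithin] with δ hδ
      have : (0 : ℝ) < δ := hδ
      exact mem_Ioi.2 (by linarith)
  have hosc := (tendsto_measure_le_oscM (P := P) hT hx hcad (half_pos hε)).comp h3
  refine tendsto_of_tendsto_of_tendsto_of_le_of_le' tendsto_const_nhds hosc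
    (Eventually.of_forall fun _ => zero_le) ?_
  filter_upwards [Ioo_mem_nhdsGT (show (0 : ℝ) < ε / 4 by linarith)] with δ hδ
  have hle : ∀ n, P {ω | ε ≤ oscM (fun t => xn n t ω) 0 T δ} ≤
      P {ω | δ ≤ dM 0 T (fun t => xn n t ω) (fun t => x t ω)} +
      P {ω | ε / 2 ≤ oscM (fun t => x t ω) 0 T (3 * δ)} := by
    intro n
    refine (measure_mono fun ω hω => ?_).trans (measure_union_le _ _)
    by_contra hn
    simp only [mem_union, mem_ofPred_eq, not_or, not_le] at hn hω
    linarith [oscM_le_of_dM_lt hT (hcadn n ω) (hcad ω) hn.1 (δ' := 3 * δ) (δ := δ) (by linarith),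
      hδ.2]
  refine (limsup_le_limsup (Eventually.of_forall hle)).trans ?_
  have := ((h δ hδ.1).add_const (P {ω | ε / 2 ≤ oscM (fun t => x t ω) 0 T (3 * δ)})).limsup_eq
  rw [this, zero_add]
  rfl

lemma tendsto_measure_le_abs_sub_of_dM [IsFiniteMeasure P] (hT : 0 < T)
    (hx : ∀ t ∈ Icc 0 T, Measurable (x t)) (hcad : ∀ ω, IsCadlagOn (fun t => x t ω) 0 T)
    (hcadn : ∀ n ω, IsCadlagOn (fun t => xn n t ω) 0 T)
    (hsc : ∀ t ∈ Icc 0 T, ∀ ε > (0 : ℝ),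
      Tendsto (fun s => P {ω | ε ≤ |x s ω - x t ω|}) (𝓝[Icc 0 T] t) (𝓝 0))
    (h : ∀ ε > (0 : ℝ), Tendsto
      (fun n => P {ω | ε ≤ dM 0 T (fun t => xn n t ω) (fun t => x t ω)}) atTop (𝓝 0))
    {t : ℝ} (ht : t ∈ Icc 0 T) {ε : ℝ} (hε : 0 < ε) :
    Tendsto (fun n => P {ω | ε ≤ |xn n t ω - x t ω|}) atTop (𝓝 0) := by
  by_cases hend : t = 0 ∨ t = T
  · refine tendsto_of_tendsto_of_tendsto_of_le_of_le tendsto_const_nhds (h ε hε)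
      (fun _ => zero_le) fun n => measure_mono fun ω hω => ?_
    by_contra hn
    exact not_lt.2 hω (abs_sub_le_of_dM_lt_of_endpoint hT (hcadn n ω) (hcad ω) (not_le.1 hn) hend)
  rw [not_or] at hend
  have ht0 : 0 < t := lt_of_le_of_ne ht.1 (Ne.symm hend.1)
  have htT : t < T := lt_of_le_of_ne ht.2 hend.2
  have hε4 : 0 < ε / 4 := by linarith
  have h3 : Tendsto (fun δ : ℝ => 3 * δ) (𝓝[>] 0) (𝓝[>] 0) := by
    refine tendsto_nhdsWithin_iff.2 ⟨?_, ?_⟩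
    · have : Continuous fun δ : ℝ => 3 * δ := by fun_prop
      simpa using (this.tendsto 0).mono_left nhdsWithin_le_nhds
    · filter_upwards [self_mem_nhdsWithin] with δ hδ
      have : (0 : ℝ) < δ := hδ
      exact mem_Ioi.2 (by linarith)
  have hosc := (tendsto_measure_le_oscM (P := P) hT hx hcad hε4).comp h3
  have hnhds : 𝓝[Icc 0 T] t = 𝓝 t := nhdsWithin_eq_nhds.2 (Icc_mem_nhds ht0 htT)
  have hl := hsc t ht _ hε4
  rw [hnhds] at hl
  have hminus : Tendsto (fun η : ℝ => t - η) (𝓝[>] 0) (𝓝 t) := by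
    have : Continuous fun η : ℝ => t - η := by fun_prop
    simpa using (this.tendsto 0).mono_left nhdsWithin_le_nhds
  have hplus : Tendsto (fun η : ℝ => t + η) (𝓝[>] 0) (𝓝 t) := by
    have : Continuous fun η : ℝ => t + η := by fun_prop
    simpa using (this.tendsto 0).mono_left nhdsWithin_le_nhds
  have hsum := (hosc.add (hl.comp hminus)).add (hl.comp hplus)
  simp only [add_zero] at hsum
  rw [ENNReal.tendsto_nhds_zero] at hsum ⊢
  intro c hc
  have hc2 : 0 < c / 2 := ENNReal.half_pos hc.ne'
  obtain ⟨η, hη, hη0, hη'⟩ := ((hsum _ hc2).and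
    (Ioo_mem_nhdsGT (lt_min hε4 (lt_min ht0 (sub_pos.2 htT))))).exists
  rw [lt_min_iff, lt_min_iff] at hη'
  obtain ⟨k1, k2, k3⟩ := hη'
  filter_upwards [(ENNReal.tendsto_nhds_zero.1 (h η hη0)) _ hc2] with n hn
  calc P {ω | ε ≤ |xn n t ω - x t ω|}
      ≤ P ({ω | η ≤ dM 0 T (fun t => xn n t ω) (fun t => x t ω)} ∪
        (({ω | ε / 4 ≤ oscM (fun t => x t ω) 0 T (3 * η)} ∪ {ω | ε / 4 ≤ |x (t - η) ω - x t ω|}) ∪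
          {ω | ε / 4 ≤ |x (t + η) ω - x t ω|})) := by
        refine measure_mono fun ω hω => ?_
        by_contra hn
        simp only [mem_union, mem_ofPred_eq, not_or, not_le] at hn hω
        obtain ⟨n1, ⟨n2, n3⟩, n4⟩ := hn
        linarith [abs_sub_le_of_dM_lt_of_mem_Ioo hT (hcadn n ω) (hcad ω) n1 (t := t) (δ := 3 * η)
          (by linarith) (by linarith) (by linarith)]
    _ ≤ c / 2 + c / 2 := by
        refine (measure_union_le _ _).trans (add_le_add hn (le_trans ?_ hη))
        exact (measure_union_le _ _).trans (add_le_add_left (measure_union_le _ _) _)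
    _ = c := ENNReal.add_halves c

lemma tendsto_measure_le_dM_of_oscM [IsFiniteMeasure P] (hT : 0 < T)
    (hx : ∀ t ∈ Icc 0 T, Measurable (x t)) (hcad : ∀ ω, IsCadlagOn (fun t => x t ω) 0 T)
    (hcadn : ∀ n ω, IsCadlagOn (fun t => xn n t ω) 0 T)
    (hfdd : ∀ t ∈ Icc 0 T, ∀ ε > (0 : ℝ),
      Tendsto (fun n => P {ω | ε ≤ |xn n t ω - x t ω|}) atTop (𝓝 0))
    (hosc : ∀ ε > (0 : ℝ), Tendsto
      (fun δ : ℝ => limsup (fun n => P {ω | ε ≤ oscM (fun t => xn n t ω) 0 T δ}) atTop)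
      (𝓝[>] 0) (𝓝 0))
    {ε : ℝ} (hε : 0 < ε) :
    Tendsto (fun n => P {ω | ε ≤ dM 0 T (fun t => xn n t ω) (fun t => x t ω)}) atTop (𝓝 0) := by
  have hε' : 0 < ε / 18 := by linarith
  rw [ENNReal.tendsto_nhds_zero]
  intro c hc
  have hc3 : 0 < c / 3 := ENNReal.div_pos hc.ne' (by simp)
  obtain ⟨δ, ⟨hδ1, hδ2⟩, hδ0⟩ := ((((hosc _ hε').eventually (gt_mem_nhds hc3)).and
    (ENNReal.tendsto_nhds_zero.1 (tendsto_measure_le_oscM (P := P) hT hx hcad hε') _ hc3)).and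
    self_mem_nhdsWithin).exists
  obtain ⟨N, hN⟩ := exists_nat_gt (T / min δ ε)
  have hm : 0 < min δ ε := lt_min hδ0 hε
  have hN0 : (0 : ℝ) < N := (div_pos hT hm).trans hN
  have hN' : T / N < min δ ε := by
    rw [div_lt_iff₀ hm] at hN
    rw [div_lt_iff₀ hN0]; linarith
  rw [lt_min_iff] at hN'
  have hgrid : ∀ i ∈ Finset.range (N + 1), 0 + (i : ℝ) * ((T - 0) / N) ∈ Icc 0 T := by
    intro i hi
    have hi' : (i : ℝ) ≤ N := by exact_mod_cast Nat.lt_succ_iff.1 (Finset.mem_range.1 hi)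
    rw [zero_add, sub_zero]
    refine ⟨by positivity, ?_⟩
    calc (i : ℝ) * (T / N) ≤ N * (T / N) := by gcongr
      _ = T := by field_simp
  have hfin := tendsto_finsetSum (Finset.range (N + 1)) fun i hi =>
    hfdd _ (hgrid i hi) _ hε'
  rw [Finset.sum_const_zero] at hfin
  filter_upwards [eventually_lt_of_limsup_lt hδ1, ENNReal.tendsto_nhds_zero.1 hfin _ hc3]
    with n hn1 hn2
  calc P {ω | ε ≤ dM 0 T (fun t => xn n t ω) (fun t => x t ω)}
      ≤ P (({ω | ε / 18 ≤ oscM (fun t => xn n t ω) 0 T δ} ∪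
          {ω | ε / 18 ≤ oscM (fun t => x t ω) 0 T δ}) ∪
          ⋃ i ∈ Finset.range (N + 1), {ω | ε / 18 ≤
            |xn n (0 + (i : ℝ) * ((T - 0) / N)) ω - x (0 + (i : ℝ) * ((T - 0) / N)) ω|}) := by
        refine measure_mono fun ω hω => ?_
        by_contra hn
        simp only [mem_union, mem_iUnion, mem_ofPred_eq, not_or, not_le, not_exists,
          Finset.mem_range] at hn hω
        obtain ⟨⟨n1, n2⟩, n3⟩ := hn
        have := dM_le_of_grid hT (hcadn n ω) (hcad ω) (N := N) (by exact_mod_cast hN0)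
          (by rw [sub_zero]; exact hN'.1) hε' n1.le n2.le fun i hi =>
            (n3 i (Nat.lt_succ_of_le hi)).le
        refine absurd (hω.trans this) (not_le.2 (max_lt ?_ ?_))
        · rw [sub_zero]; exact hN'.2
        · linarith
    _ ≤ c / 3 + c / 3 + c / 3 := by
        refine (measure_union_le _ _).trans (add_le_add ?_ ?_)
        · exact (measure_union_le _ _).trans (add_le_add hn1.le hδ2)
        · exact (measure_biUnion_finset_le _ _).trans hn2
    _ = c := ENNReal.add_thirds c

end RealValued

section WeightedSum

variable {d : ℕ → ℝ}

lemma div_one_add_le_one {y : ℝ} (hy : 0 ≤ y) : y / (1 + y) ≤ 1 := by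
  rw [div_le_one (by linarith)]; linarith

lemma summable_weighted (hd : ∀ k, 0 ≤ d k) :
    Summable fun k => (1 / 2 : ℝ) ^ (k + 1) * (d k / (1 + d k)) := by
  refine Summable.of_nonneg_of_le (fun k => ?_) (fun k => ?_)
    ((summable_nat_add_iff 1).2 summable_geometric_two)
  · have := hd k; positivity
  · exact mul_le_of_le_one_right (by positivity) (div_one_add_le_one (hd k))

lemma le_tsum_weighted (hd : ∀ k, 0 ≤ d k) {η : ℝ} (hη : 0 ≤ η) {k : ℕ} (h : η ≤ d k) :
    (1 / 2 : ℝ) ^ (k + 1) * (η / (1 + η)) ≤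
      ∑' k, (1 / 2 : ℝ) ^ (k + 1) * (d k / (1 + d k)) := by
  refine le_trans ?_ ((summable_weighted hd).le_tsum k fun j _ => ?_)
  · refine mul_le_mul_of_nonneg_left ?_ (by positivity)
    rw [div_le_div_iff₀ (by linarith) (by linarith)]
    nlinarith
  · have := hd j; positivity

lemma tsum_weighted_le (hd : ∀ k, 0 ≤ d k) (K : ℕ) :
    ∑' k, (1 / 2 : ℝ) ^ (k + 1) * (d k / (1 + d k)) ≤
      ∑ k ∈ Finset.range K, d k + (1 / 2 : ℝ) ^ K := by
  have hs := summable_weighted hd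
  rw [← hs.sum_add_tsum_nat_add K]
  refine add_le_add (Finset.sum_le_sum fun k _ => ?_) ?_
  · have h1 : d k / (1 + d k) ≤ d k := div_le_self (hd k) (by linarith [hd k])
    have h2 : (1 / 2 : ℝ) ^ (k + 1) ≤ 1 := pow_le_one₀ (by norm_num) (by norm_num)
    have h3 : 0 ≤ d k / (1 + d k) := div_nonneg (hd k) (by linarith [hd k])
    exact (mul_le_of_le_one_left h3 h2).trans h1
  · have hg : HasSum (fun k : ℕ => (1 / 2 : ℝ) ^ K * (1 / 2) * (1 / 2) ^ k)
        ((1 / 2 : ℝ) ^ K * (1 / 2) * 2) := hasSum_geometric_two.mul_left _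
    refine (Summable.tsum_le_tsum (fun k => ?_) ((summable_nat_add_iff K).2 hs)
      hg.summable).trans_eq (hg.tsum_eq.trans (by ring))
    refine (mul_le_of_le_one_right (by positivity) (div_one_add_le_one (hd _))).trans_eq ?_
    ring

end WeightedSum

/-- Convergence in probability to zero of a weighted sum of bounded transforms of nonnegative
variables amounts to that of each variable. -/
lemma tendsto_measure_tsum_weighted_iff {Ω : Type*} [MeasurableSpace Ω] {P : Measure Ω}
    {d : ℕ → ℕ → Ω → ℝ} (hd : ∀ n k ω, 0 ≤ d n k ω) :
    (∀ ε > (0 : ℝ), Tendsto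
      (fun n => P {ω | ε ≤ ∑' k, (1 / 2 : ℝ) ^ (k + 1) * (d n k ω / (1 + d n k ω))})
      atTop (𝓝 0)) ↔
    ∀ k, ∀ ε > (0 : ℝ), Tendsto (fun n => P {ω | ε ≤ d n k ω}) atTop (𝓝 0) := by
  constructor
  · intro h k ε hε
    refine tendsto_of_tendsto_of_tendsto_of_le_of_le tendsto_const_nhds
      (h ((1 / 2 : ℝ) ^ (k + 1) * (ε / (1 + ε))) (by positivity))
      (fun _ => zero_le) fun n => measure_mono fun ω hω => ?_
    exact le_tsum_weighted (fun k => hd n k ω) hε.le hω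
  · intro h ε hε
    obtain ⟨K, hK⟩ := exists_pow_lt_of_lt_one (half_pos hε) (by norm_num : (1 / 2 : ℝ) < 1)
    have hη : 0 < ε / (2 * (K + 1)) := by positivity
    have hfin := tendsto_finsetSum (Finset.range K) fun k _ => h k _ hη
    rw [Finset.sum_const_zero] at hfin
    refine tendsto_of_tendsto_of_tendsto_of_le_of_le tendsto_const_nhds hfin
      (fun _ => zero_le) fun n => ?_
    refine le_trans (measure_mono fun ω hω => ?_) (measure_biUnion_finset_le _ _)
    by_contra hn
    simp only [mem_iUnion, mem_ofPred_eq, not_le, not_exists] at hn hω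
    have h1 := tsum_weighted_le (fun k => hd n k ω) K
    have h2 : ∑ k ∈ Finset.range K, d n k ω ≤ K * (ε / (2 * (K + 1))) := by
      simpa using Finset.sum_le_sum fun k hk => (hn k hk).le
    have h3 : (K : ℝ) * (ε / (2 * (K + 1))) ≤ ε / 2 := by
      rw [← mul_div_assoc, div_le_div_iff₀ (by positivity) (by norm_num)]
      nlinarith
    linarith

lemma IsCadlagOn.inner_const {V : Type*} [NormedAddCommGroup V] [InnerProductSpace ℝ V]
    {f : ℝ → V} {a b : ℝ} (hf : IsCadlagOn f a b) (v : V) :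
    IsCadlagOn (fun t => @inner ℝ V _ (f t) v) a b :=
  ⟨fun t ht => (hf.1 t ht).inner tendsto_const_nhds, fun t ht =>
    let ⟨l, hl⟩ := hf.2 t ht
    ⟨@inner ℝ V _ l v, hl.inner tendsto_const_nhds⟩⟩

end Auxiliary

open MeasureTheory in
/-- for a separable real Hilbert space `V` with orthonormal basis `(e_k)` and
stochastically continuous processes `X`, `Xₙ` with càdlàg trajectories, convergence
`Xₙ → X` in probability in the product `M₁` metric `d_M^e` is equivalent to, for every `k`:
(i) `⟨Xₙ(t), e_k⟩ → ⟨X(t), e_k⟩` in probability for each `t`, and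
(ii) `lim_{δ↘0} limsup_n P(M(⟨Xₙ, e_k⟩; δ) ≥ ε) = 0` for every `ε > 0`. -/
theorem product_stochconv_iff_fdd_and_oscillation {V : Type*} [NormedAddCommGroup V]
    [InnerProductSpace ℝ V] [CompleteSpace V] [TopologicalSpace.SeparableSpace V]
    [MeasurableSpace V] [BorelSpace V]
    {Ω : Type*} [MeasurableSpace Ω] (P : Measure Ω) [IsProbabilityMeasure P]
    (T : ℝ) (hT : 0 < T) (e : ℕ → V) (he : Orthonormal ℝ e)
    (hdense : Dense (Submodule.span ℝ (Set.range e) : Set V))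
    (X : ℝ → Ω → V) (Xn : ℕ → ℝ → Ω → V)
    (hmeas : ∀ t ∈ Set.Icc (0:ℝ) T, Measurable (X t))
    (hmeasn : ∀ n, ∀ t ∈ Set.Icc (0:ℝ) T, Measurable (Xn n t))
    (hcad : ∀ ω, IsCadlagOn (fun t => X t ω) 0 T)
    (hcadn : ∀ n ω, IsCadlagOn (fun t => Xn n t ω) 0 T)
    (hsc : ∀ t ∈ Set.Icc (0:ℝ) T, ∀ ε > (0:ℝ),
      Filter.Tendsto (fun s => P {ω | ε ≤ ‖X s ω - X t ω‖})
        (nhdsWithin t (Set.Icc 0 T)) (nhds 0))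
    (hscn : ∀ n, ∀ t ∈ Set.Icc (0:ℝ) T, ∀ ε > (0:ℝ),
      Filter.Tendsto (fun s => P {ω | ε ≤ ‖Xn n s ω - Xn n t ω‖})
        (nhdsWithin t (Set.Icc 0 T)) (nhds 0)) :
    (∀ ε > (0:ℝ), Filter.Tendsto
        (fun n => P {ω | ε ≤ dMe T e (fun t => Xn n t ω) (fun t => X t ω)})
        Filter.atTop (nhds 0))
    ↔
    (∀ k : ℕ,
      (∀ t ∈ Set.Icc (0:ℝ) T, ∀ ε > (0:ℝ), Filter.Tendsto
        (fun n => P {ω | ε ≤ |(@inner ℝ V _ (Xn n t ω) (e k)) - (@inner ℝ V _ (X t ω) (e k))|})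
        Filter.atTop (nhds 0)) ∧
      (∀ ε > (0:ℝ), Filter.Tendsto
        (fun δ : ℝ => Filter.limsup
          (fun n => P {ω | ε ≤ oscM (fun t => (@inner ℝ V _ (Xn n t ω) (e k))) 0 T δ})
          Filter.atTop)
        (nhdsWithin 0 (Set.Ioi 0)) (nhds 0))) := by
  have hx : ∀ k, ∀ t ∈ Set.Icc (0:ℝ) T, Measurable fun ω => @inner ℝ V _ (X t ω) (e k) :=
    fun k t ht => (continuous_id.inner continuous_const).measurable.comp (hmeas t ht)
  have hc : ∀ k ω, IsCadlagOn (fun t => @inner ℝ V _ (X t ω) (e k)) 0 T :=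
    fun k ω => (hcad ω).inner_const (e k)
  have hcn : ∀ k n ω, IsCadlagOn (fun t => @inner ℝ V _ (Xn n t ω) (e k)) 0 T :=
    fun k n ω => (hcadn n ω).inner_const (e k)
  have hs : ∀ k, ∀ t ∈ Set.Icc (0:ℝ) T, ∀ ε > (0:ℝ), Filter.Tendsto
      (fun s => P {ω | ε ≤ |(@inner ℝ V _ (X s ω) (e k)) - (@inner ℝ V _ (X t ω) (e k))|})
      (nhdsWithin t (Set.Icc 0 T)) (nhds 0) := by
    intro k t ht ε hε
    refine tendsto_of_tendsto_of_tendsto_of_le_of_le tendsto_const_nhds (hsc t ht ε hε)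
      (fun _ => zero_le) fun s => measure_mono fun ω hω => ?_
    rw [Set.mem_ofPred_eq] at hω ⊢
    refine hω.trans ?_
    rw [← inner_sub_left]
    simpa [he.1 k] using abs_real_inner_le_norm (X s ω - X t ω) (e k)
  refine (tendsto_measure_tsum_weighted_iff (P := P)
    (d := fun n k ω => dM 0 T (fun t => @inner ℝ V _ (Xn n t ω) (e k))
      (fun t => @inner ℝ V _ (X t ω) (e k))) fun n k ω => dM_nonneg _ _ _ _).trans ?_
  refine forall_congr' fun k => ⟨fun h => ⟨fun t ht ε hε => ?_, fun ε hε => ?_⟩, fun h ε hε => ?_⟩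
  · exact tendsto_measure_le_abs_sub_of_dM (x := fun t ω => @inner ℝ V _ (X t ω) (e k))
      (xn := fun n t ω => @inner ℝ V _ (Xn n t ω) (e k)) hT (hx k) (hc k) (hcn k) (hs k) h ht hε
  · exact tendsto_limsup_measure_le_oscM_of_dM (x := fun t ω => @inner ℝ V _ (X t ω) (e k))
      (xn := fun n t ω => @inner ℝ V _ (Xn n t ω) (e k)) hT (hx k) (hc k) (hcn k) h hε
  · exact tendsto_measure_le_dM_of_oscM (x := fun t ω => @inner ℝ V _ (X t ω) (e k))
      (xn := fun n t ω => @inner ℝ V _ (Xn n t ω) (e k)) hT (hx k) (hc k) (hcn k) h.1 h.2 hε
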